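/- arXiv:1710.10735 — 5 statements merged into one kernel-verified Lean document; each statement's English description precedes it below -/
import Mathlib

section
/- Let n ≥ 2 and suppose the configuration satisfies (H1) and (H2). Fix j∈N. Then ⋂_{k∈N∖{j}}S_k consists of exactly two points P_j and P_j′ (P_j being the one on ∂D), f_j is nonzero at both, and: 1/f_j(P_j) = ((−1)^{n+1}√(B(0⋆∂_jN)·B(0N)) + B(0⋆∂_jN | 0 j ∂_jN)) / B(0⋆N) < 0, 1/f_j(P_j′) = ((−1)^{n}√(B(0⋆∂_jN)·B(0N)) + B(0⋆∂_jN | 0 j ∂_jN)) / B(0⋆N) > 0, and consequently (1/f_j(P_j))·(1/f_j(P_j′)) = − B(0 ∂_jN)/B(0⋆N) < 0, where ∂_jN := N∖{j}. -/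
open MeasureTheory Metric Finset
open scoped BigOperators

namespace SchlafliVol

/-- Row/column labels for Cayley–Menger determinants: `zero` = 0, `star` = ⋆,
`idx j` = the hypersphere index `j ∈ N`. -/
inductive Lbl (m : ℕ) : Type where
  | zero : Lbl m
  | star : Lbl m
  | idx : Fin m → Lbl m

variable {m : ℕ}

/-- The entry of the Cayley–Menger matrix attached to a pair of labels,
for radii `rad` and mutual center distances `ρ`. -/
def ent (rad : Fin m → ℝ) (ρ : Fin m → Fin m → ℝ) : Lbl m → Lbl m → ℝ
  | Lbl.zero, Lbl.zero => 0
  | Lbl.star, Lbl.star => 0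
  | Lbl.zero, Lbl.star => 1
  | Lbl.star, Lbl.zero => 1
  | Lbl.zero, Lbl.idx _ => 1
  | Lbl.idx _, Lbl.zero => 1
  | Lbl.star, Lbl.idx k => rad k ^ 2
  | Lbl.idx j, Lbl.star => rad j ^ 2
  | Lbl.idx j, Lbl.idx k => ρ j k ^ 2

/-- `B(R|C)`: the Cayley–Menger determinant attached to two equal-length
sequences of labels. -/
noncomputable def Bdet (rad : Fin m → ℝ) (ρ : Fin m → Fin m → ℝ) {p : ℕ}
    (R C : Fin p → Lbl m) : ℝ :=
  Matrix.det (Matrix.of fun i j => ent rad ρ (R i) (C j))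

/-- The label sequence `(0, J)` (elements of `J` in increasing order). -/
noncomputable def seq0 (J : Finset (Fin m)) : Fin (J.card + 1) → Lbl m :=
  Fin.cons Lbl.zero fun i => Lbl.idx (J.orderEmbOfFin rfl i)

/-- The label sequence `(0, ⋆, J)`. -/
noncomputable def seq0s (J : Finset (Fin m)) : Fin (J.card + 1 + 1) → Lbl m :=
  Fin.cons Lbl.zero <| Fin.cons Lbl.star fun i => Lbl.idx (J.orderEmbOfFin rfl i)

/-- The label sequence `(0, ν, J)`. -/
noncomputable def seq0i (ν : Fin m) (J : Finset (Fin m)) : Fin (J.card + 1 + 1) → Lbl m :=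
  Fin.cons Lbl.zero <| Fin.cons (Lbl.idx ν) fun i => Lbl.idx (J.orderEmbOfFin rfl i)

/-- `B(0J)`. -/
noncomputable def B0 (rad : Fin m → ℝ) (ρ : Fin m → Fin m → ℝ) (J : Finset (Fin m)) : ℝ :=
  Bdet rad ρ (seq0 J) (seq0 J)

/-- `B(0⋆J)`. -/
noncomputable def B0s (rad : Fin m → ℝ) (ρ : Fin m → Fin m → ℝ) (J : Finset (Fin m)) : ℝ :=
  Bdet rad ρ (seq0s J) (seq0s J)

/-- `B(0 ⋆ K | 0 ν K)`. -/
noncomputable def Bmix (rad : Fin m → ℝ) (ρ : Fin m → Fin m → ℝ) (ν : Fin m)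
    (K : Finset (Fin m)) : ℝ :=
  Bdet rad ρ (seq0s K) (seq0i ν K)

/-- `B(0 L)` for an ordered list `L` of indices. -/
noncomputable def B0L (rad : Fin m → ℝ) (ρ : Fin m → Fin m → ℝ) (L : List (Fin m)) : ℝ :=
  Bdet rad ρ (Fin.cons Lbl.zero fun i => Lbl.idx (L.get i))
    (Fin.cons Lbl.zero fun i => Lbl.idx (L.get i))

/-- `B(0 ⋆ L | 0 ν L)` for an ordered list `L` of indices. -/
noncomputable def BmixL (rad : Fin m → ℝ) (ρ : Fin m → Fin m → ℝ) (ν : Fin m)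
    (L : List (Fin m)) : ℝ :=
  Bdet rad ρ (Fin.cons Lbl.zero <| Fin.cons Lbl.star fun i => Lbl.idx (L.get i))
    (Fin.cons Lbl.zero <| Fin.cons (Lbl.idx ν) fun i => Lbl.idx (L.get i))

/-- Given an ordered sequence `μ₁ :: μ₂ :: …` (first argument) and the current
tail `(μ_{ν-1}, …, μ₁, j, k)` (second argument), the product
`∏_ν B(0 ⋆ μ_{ν-1}⋯μ₁ j k | 0 μ_ν μ_{ν-1}⋯μ₁ j k) / B(0 μ_ν μ_{ν-1}⋯μ₁ j k)`. -/
noncomputable def thetaProd (rad : Fin m → ℝ) (ρ : Fin m → Fin m → ℝ) :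
    List (Fin m) → List (Fin m) → ℝ
  | [], _ => 1
  | μ :: rest, tail =>
      (BmixL rad ρ μ tail / B0L rad ρ (μ :: tail)) * thetaProd rad ρ rest (μ :: tail)

/-- The 1-form coefficient `Θ_J(t)` along a family `t ↦ (rad t, ρ t)`:
`Θ_j = -(1/2) d/dt log r_j²` and, for `|J| = p ≥ 2`,
`Θ_J = (-1)^p Σ_{{j,k}⊆J} (1/2)(d/dt log B(0jk)) Σ_{(μ₁,…,μ_{p-2})} ∏ …`. -/
noncomputable def Theta (rad : ℝ → Fin m → ℝ) (ρ : ℝ → Fin m → Fin m → ℝ)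
    (J : Finset (Fin m)) (t : ℝ) : ℝ :=
  if J.card = 1 then
    ∑ j ∈ J, -(1 / 2 : ℝ) * deriv (fun s => Real.log (rad s j ^ 2)) t
  else
    (-1 : ℝ) ^ J.card *
      ∑ j ∈ J, ∑ k ∈ J,
        (if j < k then
          (1 / 2 : ℝ) * deriv (fun s => Real.log (B0 (rad s) (ρ s) {j, k})) t *
            ((((J \ {j, k}).sort (· ≤ ·)).permutations.map
              fun L => thetaProd (rad t) (ρ t) L [j, k]).sum)
        else 0)

/-- Hypothesis (H1). -/
def H1 (rad : Fin m → ℝ) (ρ : Fin m → Fin m → ℝ) : Prop :=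
  ∀ J : Finset (Fin m), J.Nonempty →
    0 < (-1 : ℝ) ^ J.card * B0 rad ρ J ∧ 0 < (-1 : ℝ) ^ (J.card + 1) * B0s rad ρ J

/-- Hypothesis (H1′). -/
def H1' {n : ℕ} (rad : Fin (n + 1) → ℝ) (ρ : Fin (n + 1) → Fin (n + 1) → ℝ) : Prop :=
  (∀ J : Finset (Fin (n + 1)), J.Nonempty → J.card ≤ n →
    0 < (-1 : ℝ) ^ J.card * B0 rad ρ J ∧ 0 < (-1 : ℝ) ^ (J.card + 1) * B0s rad ρ J) ∧
  0 < (-1 : ℝ) ^ (n + 1) * B0 rad ρ (Finset.univ : Finset (Fin (n + 1))) ∧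
  (-1 : ℝ) ^ n * B0s rad ρ (Finset.univ : Finset (Fin (n + 1))) < 0

variable {n : ℕ}

/-- The quadratic polynomial `f_j(x) = |x|² + 2⟨a_j, x⟩ + α_{j0}`. -/
noncomputable def fQ (a : Fin (n + 1) → EuclideanSpace ℝ (Fin n)) (α0 : Fin (n + 1) → ℝ)
    (j : Fin (n + 1)) (x : EuclideanSpace ℝ (Fin n)) : ℝ :=
  ‖x‖ ^ 2 + 2 * (inner ℝ (a j) x : ℝ) + α0 j

/-- The radius `r_j = √(|a_j|² - α_{j0})` of the hypersphere `S_j`. -/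
noncomputable def radius (a : Fin (n + 1) → EuclideanSpace ℝ (Fin n)) (α0 : Fin (n + 1) → ℝ)
    (j : Fin (n + 1)) : ℝ :=
  Real.sqrt (‖a j‖ ^ 2 - α0 j)

/-- The mutual distance `ρ_{jk} = |O_j - O_k|` of the centers `O_j = -a_j`. -/
noncomputable def cdist (a : Fin (n + 1) → EuclideanSpace ℝ (Fin n)) (j k : Fin (n + 1)) : ℝ :=
  dist (a j) (a k)

/-- The intersection `S_J = ⋂_{j ∈ J} S_j` of the hyperspheres `S_j = {f_j = 0}`. -/
def sphI (a : Fin (n + 1) → EuclideanSpace ℝ (Fin n)) (α0 : Fin (n + 1) → ℝ)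
    (J : Finset (Fin (n + 1))) : Set (EuclideanSpace ℝ (Fin n)) :=
  {x | ∀ j ∈ J, fQ a α0 j x = 0}

/-- The pseudo-simplex `D = D_N^- = ⋂_j {f_j ≤ 0}`. -/
def Dm (a : Fin (n + 1) → EuclideanSpace ℝ (Fin n)) (α0 : Fin (n + 1) → ℝ) :
    Set (EuclideanSpace ℝ (Fin n)) :=
  {x | ∀ j, fQ a α0 j x ≤ 0}

/-- The chamber `D_N^+ = ⋂_j {f_j ≥ 0}`. -/
def Dp (a : Fin (n + 1) → EuclideanSpace ℝ (Fin n)) (α0 : Fin (n + 1) → ℝ) :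
    Set (EuclideanSpace ℝ (Fin n)) :=
  {x | ∀ j, 0 ≤ fQ a α0 j x}

/-- The chamber `D_K^- ∩ D_{K^c}^+`. -/
def Dmix (a : Fin (n + 1) → EuclideanSpace ℝ (Fin n)) (α0 : Fin (n + 1) → ℝ)
    (K : Finset (Fin (n + 1))) : Set (EuclideanSpace ℝ (Fin n)) :=
  {x | ∀ j, if j ∈ K then fQ a α0 j x ≤ 0 else 0 ≤ fQ a α0 j x}

/-- Normalized triangular form: `α_{jν} = 0` for `ν > n + 1 - j`
(1-based paper indices; here `j`, `ν` are 0-based). -/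
def Triangular (a : Fin (n + 1) → EuclideanSpace ℝ (Fin n)) : Prop :=
  ∀ j : Fin (n + 1), ∀ ν : Fin n, n - (j : ℕ) ≤ (ν : ℕ) → a j ν = 0

/-- Positivity `α_{j, n+1-j} > 0` of the diagonal coefficients (`1 ≤ j ≤ n`). -/
def DiagPos (a : Fin (n + 1) → EuclideanSpace ℝ (Fin n)) : Prop :=
  ∀ j : Fin (n + 1), ∀ ν : Fin n, (j : ℕ) < n → (ν : ℕ) = n - (j : ℕ) - 1 → 0 < a j ν

/-- Hypothesis (H2): the `(n+1-j)`-th coordinate of the vertex `P_j` is negative. -/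
def H2 (P : Fin (n + 1) → EuclideanSpace ℝ (Fin n)) : Prop :=
  ∀ j : Fin (n + 1), ∀ ν : Fin n, (j : ℕ) < n → (ν : ℕ) = n - (j : ℕ) - 1 → P j ν < 0

/-- The rational function `W₀(J)`. -/
noncomputable def W0 (a : Fin (n + 1) → EuclideanSpace ℝ (Fin n)) (α0 : Fin (n + 1) → ℝ)
    (J : Finset (Fin (n + 1))) (x : EuclideanSpace ℝ (Fin n)) : ℝ :=
  - ∑ ν ∈ J, Bmix (radius a α0) (cdist a) ν (J.erase ν) * ∏ μ ∈ J.erase ν, (fQ a α0 μ x)⁻¹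
    + B0s (radius a α0) (cdist a) J * ∏ μ ∈ J, (fQ a α0 μ x)⁻¹


section Determinants

variable {E : Type*} [NormedAddCommGroup E] [InnerProductSpace ℝ E]

/-- A Cayley–Menger determinant of affinely dependent points vanishes. -/
theorem cayleyMenger_det_eq_zero {p : ℕ} (q : Fin p → E)
    (M : Matrix (Fin (p + 1)) (Fin (p + 1)) ℝ) (h00 : M 0 0 = 0)
    (h0 : ∀ i, M 0 (Fin.succ i) = 1) (h1 : ∀ i, M (Fin.succ i) 0 = 1)
    (hM : ∀ i k, M (Fin.succ i) (Fin.succ k) = dist (q i) (q k) ^ 2)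
    (hq : ¬ AffineIndependent ℝ q) : M.det = 0 := by
  rw [affineIndependent_iff] at hq
  push Not at hq
  obtain ⟨s, w, hw, hwq, i₀, hi₀, hne⟩ := hq
  classical
  set w' : Fin p → ℝ := fun i => if i ∈ s then w i else 0 with hw'
  have hsum : ∑ i, w' i = 0 := by simpa [hw'] using hw
  have hsumq : ∑ i, w' i • q i = 0 := by simpa [hw', ite_smul] using hwq
  refine Matrix.exists_mulVec_eq_zero_iff.mp
    ⟨Fin.cons (-∑ i, w' i * ‖q i‖ ^ 2) w', ?_, ?_⟩
  · intro h
    have := congrFun h i₀.succ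
    simp [hw', hi₀, hne] at this
  · ext i
    refine Fin.cases ?_ (fun i => ?_) i
    · simp [Matrix.mulVec, dotProduct, Fin.sum_univ_succ, h00, h0, hsum]
    · simp only [Matrix.mulVec, dotProduct, Fin.sum_univ_succ, h1, hM, Fin.cons_zero,
        Fin.cons_succ, Pi.zero_apply, one_mul]
      have hinner : ∑ k, w' k * inner ℝ (q i) (q k) = 0 := by
        simpa [inner_sum, inner_smul_right] using congrArg (inner ℝ (q i)) hsumq
      have hterm : ∀ k, dist (q i) (q k) ^ 2 * w' k =
          ‖q i‖ ^ 2 * w' k - 2 * (w' k * inner ℝ (q i) (q k)) + w' k * ‖q k‖ ^ 2 := by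
        intro k
        rw [dist_eq_norm, norm_sub_sq_real]
        ring
      simp_rw [hterm, sum_add_distrib, sum_sub_distrib, ← mul_sum, hsum, hinner]
      ring

theorem exists_equiv_comp_eq_of_range_eq {α β γ : Type*} {f : α → γ} {g : β → γ}
    (hf : f.Injective) (hg : g.Injective) (h : Set.range f = Set.range g) :
    ∃ e : α ≃ β, g ∘ e = f := by
  refine ⟨(Equiv.ofInjective f hf).trans ((Equiv.setCongr h).trans
    (Equiv.ofInjective g hg).symm), ?_⟩
  ext x
  simp [Equiv.apply_ofInjective_symm]

/-- The determinant of a matrix of entries depends only on the set of labels. -/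
theorem det_ent_eq_of_range_eq {α β : Type*} [Fintype α] [DecidableEq α] [Fintype β]
    [DecidableEq β] (rad : Fin m → ℝ) (ρ : Fin m → Fin m → ℝ) {f : α → Lbl m} {g : β → Lbl m}
    (hf : f.Injective) (hg : g.Injective) (h : Set.range f = Set.range g) :
    (Matrix.of fun i k => ent rad ρ (f i) (f k)).det =
      (Matrix.of fun i k => ent rad ρ (g i) (g k)).det := by
  obtain ⟨e, rfl⟩ := exists_equiv_comp_eq_of_range_eq hf hg h
  exact Matrix.det_submatrix_equiv_self e (Matrix.of fun i k => ent rad ρ (g i) (g k))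

/-- The entry at labels `u`, `v` of the Schur complement of the `0J`-block. -/
noncomputable def schurEnt (rad : Fin m → ℝ) (ρ : Fin m → Fin m → ℝ) (J : Finset (Fin m))
    (u v : Lbl m) : ℝ :=
  ent rad ρ u v - ∑ k, (∑ i, ent rad ρ u (seq0 J i) *
    (Matrix.of fun i k => ent rad ρ (seq0 J i) (seq0 J k))⁻¹ i k) * ent rad ρ (seq0 J k) v

/-- Schur complement formula for label sequences extending `0J`. -/
theorem det_ent_sumElim {α : Type*} [Fintype α] [DecidableEq α] (rad : Fin m → ℝ)
    (ρ : Fin m → Fin m → ℝ) (J : Finset (Fin m)) (h : B0 rad ρ J ≠ 0) (u v : α → Lbl m) :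
    (Matrix.of fun i k => ent rad ρ (Sum.elim u (seq0 J) i) (Sum.elim v (seq0 J) k)).det =
      B0 rad ρ J * (Matrix.of fun i k => schurEnt rad ρ J (u i) (v k)).det := by
  have hblock : (Matrix.of fun i k =>
      ent rad ρ (Sum.elim u (seq0 J) i) (Sum.elim v (seq0 J) k)) =
      Matrix.fromBlocks (Matrix.of fun i k => ent rad ρ (u i) (v k))
        (Matrix.of fun i k => ent rad ρ (u i) (seq0 J k))
        (Matrix.of fun i k => ent rad ρ (seq0 J i) (v k))
        (Matrix.of fun i k => ent rad ρ (seq0 J i) (seq0 J k)) := by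
    ext (i | i) (k | k) <;> rfl
  have hunit : IsUnit (Matrix.of fun i k => ent rad ρ (seq0 J i) (seq0 J k)) := by
    rw [Matrix.isUnit_iff_isUnit_det]
    exact isUnit_iff_ne_zero.mpr h
  let := hunit.invertible
  rw [hblock, Matrix.det_fromBlocks₂₂, Matrix.invOf_eq_nonsing_inv]
  rfl

/-- Swapping the first two labels of both sequences. -/
theorem Bdet_cons_cons_swap (rad : Fin m → ℝ) (ρ : Fin m → Fin m → ℝ) {p : ℕ}
    (x y u v : Lbl m) (e : Fin p → Lbl m) :
    Bdet rad ρ (Fin.cons x (Fin.cons u e)) (Fin.cons y (Fin.cons v e)) =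
      Bdet rad ρ (Fin.cons u (Fin.cons x e)) (Fin.cons v (Fin.cons y e)) := by
  have hswap : ∀ s t : Lbl m, (Fin.cons s (Fin.cons t e) : Fin (p + 2) → Lbl m) ∘
      Equiv.swap 0 1 = Fin.cons t (Fin.cons s e) := by
    intro s t
    ext i
    refine Fin.cases ?_ (fun i => Fin.cases ?_ (fun i => ?_) i) i
    · simp only [Function.comp, Equiv.swap_apply_left]; rfl
    · have : (Fin.succ 0 : Fin (p + 2)) = 1 := rfl
      simp only [this, Function.comp, Equiv.swap_apply_right]; rfl
    · rw [Function.comp, Equiv.swap_apply_of_ne_of_ne]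
      · rfl
      · exact Fin.succ_ne_zero _
      · intro h
        exact Fin.succ_ne_zero i (Fin.succ_injective _ h)
  unfold Bdet
  rw [← hswap x u, ← hswap y v]
  exact (Matrix.det_submatrix_equiv_self (Equiv.swap (0 : Fin (p + 2)) 1) (Matrix.of fun i k =>
    ent rad ρ ((Fin.cons x (Fin.cons u e) : Fin (p + 2) → Lbl m) i)
      ((Fin.cons y (Fin.cons v e) : Fin (p + 2) → Lbl m) k))).symm

theorem Bdet_cons_seq0 (rad : Fin m → ℝ) (ρ : Fin m → Fin m → ℝ) (J : Finset (Fin m))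
    (h : B0 rad ρ J ≠ 0) (u v : Lbl m) :
    Bdet rad ρ (Fin.cons u (seq0 J)) (Fin.cons v (seq0 J)) =
      B0 rad ρ J * schurEnt rad ρ J u v := by
  have key := det_ent_sumElim rad ρ J h (fun _ : Unit => u) (fun _ => v)
  rw [Matrix.det_unique (Matrix.of fun _ _ : Unit => schurEnt rad ρ J u v),
    Matrix.of_apply] at key
  rw [← key, Bdet]
  let σ : Unit ⊕ Fin (J.card + 1) ≃ Fin (J.card + 1 + 1) :=
    (Equiv.sumComm _ _).trans ((Equiv.optionEquivSumPUnit _).symm.trans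
      (finSuccEquiv _).symm)
  rw [← Matrix.det_submatrix_equiv_self σ]
  congr 1
  ext (i | i) (k | k) <;> simp [σ]

theorem Bmix_eq_schurEnt (rad : Fin m → ℝ) (ρ : Fin m → Fin m → ℝ) (J : Finset (Fin m))
    (h : B0 rad ρ J ≠ 0) (j : Fin m) :
    Bmix rad ρ j J = B0 rad ρ J * schurEnt rad ρ J Lbl.star (Lbl.idx j) := by
  rw [← Bdet_cons_seq0 rad ρ J h]
  exact Bdet_cons_cons_swap _ _ _ _ _ _ _

theorem B0s_eq_schurEnt (rad : Fin m → ℝ) (ρ : Fin m → Fin m → ℝ) (J : Finset (Fin m))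
    (h : B0 rad ρ J ≠ 0) :
    B0s rad ρ J = B0 rad ρ J * schurEnt rad ρ J Lbl.star Lbl.star := by
  rw [← Bdet_cons_seq0 rad ρ J h]
  exact Bdet_cons_cons_swap _ _ _ _ _ _ _

theorem seq0_injective (J : Finset (Fin m)) : (seq0 J).Injective := by
  refine Fin.cons_injective_iff.mpr ⟨by simp, ?_⟩
  intro i k h
  simpa using h

theorem range_seq0 (J : Finset (Fin m)) :
    Set.range (seq0 J) = insert Lbl.zero (Set.image Lbl.idx (J : Set (Fin m))) := by
  rw [seq0, Fin.range_cons, ← Finset.range_orderEmbOfFin J rfl, ← Set.range_comp]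
  rfl

theorem range_seq0s (J : Finset (Fin m)) : Set.range (seq0s J) =
    insert Lbl.zero (insert Lbl.star (Set.image Lbl.idx (J : Set (Fin m)))) := by
  rw [seq0s, Fin.range_cons, Fin.range_cons, ← Finset.range_orderEmbOfFin J rfl,
    ← Set.range_comp]
  rfl

theorem seq0s_injective (J : Finset (Fin m)) : (seq0s J).Injective := by
  refine Fin.cons_injective_iff.mpr ⟨?_, Fin.cons_injective_iff.mpr ⟨by simp, ?_⟩⟩
  · rw [Fin.range_cons]; simp
  · intro i k h
    simpa using h

theorem B0_univ_eq_schurEnt (rad : Fin m → ℝ) (ρ : Fin m → Fin m → ℝ) (j : Fin m)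
    (h : B0 rad ρ (univ.erase j) ≠ 0) :
    B0 rad ρ univ = B0 rad ρ (univ.erase j) *
      schurEnt rad ρ (univ.erase j) (Lbl.idx j) (Lbl.idx j) := by
  rw [← Bdet_cons_seq0 _ _ _ h]
  refine det_ent_eq_of_range_eq rad ρ (seq0_injective _)
    (Fin.cons_injective_iff.mpr ⟨?_, seq0_injective _⟩) ?_
  · rw [range_seq0]; simp
  · rw [Fin.range_cons, range_seq0, range_seq0, Set.insert_comm, ← Set.image_insert_eq]
    congr 2
    ext k
    simp

theorem ent_comm (rad : Fin m → ℝ) (ρ : Fin m → Fin m → ℝ) (hρ : ∀ i k, ρ i k = ρ k i)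
    (u v : Lbl m) : ent rad ρ u v = ent rad ρ v u := by
  cases u <;> cases v <;> simp [ent, hρ]

theorem schurEnt_comm (rad : Fin m → ℝ) (ρ : Fin m → Fin m → ℝ) (hρ : ∀ i k, ρ i k = ρ k i)
    (J : Finset (Fin m)) (u v : Lbl m) : schurEnt rad ρ J u v = schurEnt rad ρ J v u := by
  have hinv : ∀ i k, (Matrix.of fun i k => ent rad ρ (seq0 J i) (seq0 J k))⁻¹ i k =
      (Matrix.of fun i k => ent rad ρ (seq0 J i) (seq0 J k))⁻¹ k i := by
    intro i k
    have hT : (Matrix.of fun i k => ent rad ρ (seq0 J i) (seq0 J k)).transpose =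
        Matrix.of fun i k => ent rad ρ (seq0 J i) (seq0 J k) := by
      ext i k
      exact ent_comm rad ρ hρ _ _
    conv_lhs => rw [← hT, ← Matrix.transpose_nonsing_inv, Matrix.transpose_apply]
  unfold schurEnt
  simp_rw [sum_mul]
  rw [sum_comm, ent_comm rad ρ hρ u v]
  congr 1
  refine sum_congr rfl fun i _ => sum_congr rfl fun k _ => ?_
  rw [ent_comm rad ρ hρ u, ent_comm rad ρ hρ _ v, hinv i k]
  ring

theorem B0s_univ_eq_schurEnt (rad : Fin m → ℝ) (ρ : Fin m → Fin m → ℝ)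
    (hρ : ∀ i k, ρ i k = ρ k i) (j : Fin m) (h : B0 rad ρ (univ.erase j) ≠ 0) :
    B0s rad ρ univ = B0 rad ρ (univ.erase j) *
      (schurEnt rad ρ (univ.erase j) Lbl.star Lbl.star *
        schurEnt rad ρ (univ.erase j) (Lbl.idx j) (Lbl.idx j) -
        schurEnt rad ρ (univ.erase j) Lbl.star (Lbl.idx j) ^ 2) := by
  have key := det_ent_sumElim rad ρ _ h ![Lbl.star, Lbl.idx j] ![Lbl.star, Lbl.idx j]
  rw [Matrix.det_fin_two (Matrix.of _)] at key
  simp only [Matrix.of_apply, Matrix.cons_val_zero, Matrix.cons_val_one,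
    schurEnt_comm rad ρ hρ _ (Lbl.idx j) Lbl.star] at key
  rw [sq, ← key]
  refine det_ent_eq_of_range_eq rad ρ (seq0s_injective _)
    (Function.Injective.sumElim ?_ (seq0_injective _) ?_) ?_
  · intro i k
    fin_cases i <;> fin_cases k <;> simp
  · intro i k hik
    have : seq0 (univ.erase j) k ∈ Set.range (seq0 (univ.erase j)) := ⟨k, rfl⟩
    rw [range_seq0, ← hik] at this
    fin_cases i <;> simp at this
  · rw [Set.Sum.elim_range, range_seq0s, range_seq0]
    ext l
    cases l with
    | zero => simp
    | star => simp
    | idx k => by_cases hk : k = j <;> simp [hk]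

end Determinants

/-- Changing the radii outside `J` affects the Schur complement of the `0J`-block only through
the entry itself. -/
theorem schurEnt_congr (rad rad' : Fin m → ℝ) (ρ : Fin m → Fin m → ℝ) (J : Finset (Fin m))
    (h : ∀ k ∈ J, rad' k ^ 2 = rad k ^ 2) (u v : Lbl m) :
    schurEnt rad' ρ J u v = schurEnt rad ρ J u v + (ent rad' ρ u v - ent rad ρ u v) := by
  have hl : ∀ i w, ent rad' ρ w (seq0 J i) = ent rad ρ w (seq0 J i) := by
    intro i w
    refine Fin.cases ?_ (fun i => ?_) i
    · cases w <;> rfl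
    · have := h _ (J.orderEmbOfFin_mem rfl i)
      cases w <;> simp [seq0, ent, this]
  have hr : ∀ i w, ent rad' ρ (seq0 J i) w = ent rad ρ (seq0 J i) w := by
    intro i w
    refine Fin.cases ?_ (fun i => ?_) i
    · cases w <;> rfl
    · have := h _ (J.orderEmbOfFin_mem rfl i)
      cases w <;> simp [seq0, ent, this]
  unfold schurEnt
  simp only [hl, hr]
  ring

/-- `B(0J)` does not depend on the radii. -/
theorem B0_congr (rad rad' : Fin m → ℝ) (ρ : Fin m → Fin m → ℝ) (J : Finset (Fin m)) :
    B0 rad' ρ J = B0 rad ρ J := by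
  unfold B0 Bdet
  congr 1
  ext i k
  refine Fin.cases (Fin.cases ?_ (fun k => ?_) k)
    (fun i => Fin.cases ?_ (fun k => ?_) k) i <;> rfl

section Spheres

variable (a : Fin (n + 1) → EuclideanSpace ℝ (Fin n)) (α0 : Fin (n + 1) → ℝ)

theorem cdist_comm (i k : Fin (n + 1)) : cdist a i k = cdist a k i := dist_comm _ _

theorem fQ_eq_dist_sq (hrad : ∀ j, 0 < ‖a j‖ ^ 2 - α0 j) (x : EuclideanSpace ℝ (Fin n))
    (k : Fin (n + 1)) : dist (-x) (a k) ^ 2 = radius a α0 k ^ 2 + fQ a α0 k x := by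
  rw [radius, Real.sq_sqrt (hrad k).le, fQ, dist_eq_norm, ← neg_add', norm_neg,
    norm_add_sq_real, real_inner_comm]
  ring

theorem fQ_add_smul (k : Fin (n + 1)) (x u : EuclideanSpace ℝ (Fin n)) (t : ℝ) :
    fQ a α0 k (x + t • u) =
      fQ a α0 k x + t * (2 * inner ℝ (x + a k) u + t * ‖u‖ ^ 2) := by
  simp only [fQ, norm_add_sq_real, norm_smul, inner_add_right, inner_add_left,
    real_inner_smul_right, mul_pow, Real.norm_eq_abs, sq_abs]
  ring

/-- The Cayley–Menger determinant `B(0⋆J)` for the radii `|x - O_k|` vanishes when `x` and the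
centers are affinely dependent. -/
theorem B0s_dist_eq_zero (x : EuclideanSpace ℝ (Fin n)) (J : Finset (Fin (n + 1)))
    (h : ¬ AffineIndependent ℝ (Fin.cons x (fun i => a (J.orderEmbOfFin rfl i)) :
      Fin (J.card + 1) → EuclideanSpace ℝ (Fin n))) :
    B0s (fun k => dist x (a k)) (cdist a) J = 0 := by
  refine cayleyMenger_det_eq_zero _ _ rfl ?_ ?_ ?_ h
  · intro i
    refine Fin.cases ?_ (fun i => ?_) i <;> rfl
  · intro i
    refine Fin.cases ?_ (fun i => ?_) i <;> rfl
  · intro i k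
    refine Fin.cases (Fin.cases ?_ (fun k => ?_) k)
      (fun i => Fin.cases ?_ (fun k => ?_) k) i
    · simp [seq0s, ent]
    · simp [seq0s, ent]
    · simp [seq0s, ent, dist_comm]
    · simp [seq0s, ent, cdist]

theorem affineIndependent_of_B0_ne_zero (rad : Fin (n + 1) → ℝ)
    (h : B0 rad (cdist a) univ ≠ 0) : AffineIndependent ℝ a := by
  by_contra hne
  apply h
  have hdet := det_ent_eq_of_range_eq rad (cdist a) (seq0_injective univ)
    (g := Fin.cons Lbl.zero Lbl.idx)
    (Fin.cons_injective_iff.mpr ⟨by simp, fun i k hik => by simpa using hik⟩) (by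
      rw [range_seq0, Fin.range_cons]; simp)
  rw [B0, Bdet, hdet]
  exact cayleyMenger_det_eq_zero a _ rfl (fun _ => rfl) (fun _ => rfl) (fun _ _ => rfl) hne

/-- A vector orthogonal to all differences of `n + 1` affinely independent points vanishes. -/
theorem eq_zero_of_inner_sub_eq_zero {q : Fin (n + 1) → EuclideanSpace ℝ (Fin n)}
    (hq : AffineIndependent ℝ q) {u : EuclideanSpace ℝ (Fin n)}
    (hu : ∀ i k, inner ℝ (q i - q k) u = 0) : u = 0 := by
  have htop : vectorSpan ℝ (Set.range q) = ⊤ :=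
    hq.vectorSpan_eq_top_of_card_eq_finrank_add_one (by simp)
  have hle : vectorSpan ℝ (Set.range q) ≤ (ℝ ∙ u)ᗮ := by
    rw [vectorSpan_def, Submodule.span_le]
    rintro _ ⟨_, ⟨i, rfl⟩, _, ⟨k, rfl⟩, rfl⟩
    rw [SetLike.mem_coe, Submodule.mem_orthogonal_singleton_iff_inner_left]
    exact hu i k
  have hmem : u ∈ (ℝ ∙ u)ᗮ := hle (htop ▸ Submodule.mem_top)
  rwa [Submodule.mem_orthogonal_singleton_iff_inner_left, inner_self_eq_zero] at hmem

/-- The centers other than `O_j` lie in a common hyperplane. -/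
theorem exists_ne_zero_inner_sub_eq_zero (hn : 0 < n) (j : Fin (n + 1)) :
    ∃ u : EuclideanSpace ℝ (Fin n), u ≠ 0 ∧
      ∀ i k, i ≠ j → k ≠ j → inner ℝ (a i - a k) u = 0 := by
  obtain ⟨d, rfl⟩ := Nat.exists_eq_add_of_lt hn
  set V := vectorSpan ℝ (Set.range fun i => a (j.succAbove i))
  have hV : Module.finrank ℝ V ≤ d :=
    finrank_vectorSpan_range_le ℝ _ (by simp)
  have hne : Vᗮ ≠ ⊥ := by
    intro h
    rw [Submodule.orthogonal_eq_bot_iff] at h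
    rw [h, finrank_top, finrank_euclideanSpace_fin] at hV
    omega
  obtain ⟨u, hu, hu0⟩ := Submodule.exists_mem_ne_zero_of_ne_bot hne
  refine ⟨u, hu0, fun i k hi hk => ?_⟩
  obtain ⟨i, rfl⟩ := Fin.exists_succAbove_eq hi
  obtain ⟨k, rfl⟩ := Fin.exists_succAbove_eq hk
  exact (Submodule.mem_orthogonal V u).mp hu _
    (vsub_mem_vectorSpan ℝ (Set.mem_range_self i) (Set.mem_range_self k))

/-- The quadratic equation satisfied by `f_j` at the points of `⋂_{k≠j} S_k`. -/
theorem sq_schurEnt_add_fQ (hrad : ∀ j, 0 < ‖a j‖ ^ 2 - α0 j) (j : Fin (n + 1))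
    (h : B0 (radius a α0) (cdist a) (univ.erase j) ≠ 0) (x : EuclideanSpace ℝ (Fin n))
    (hx : ∀ k, k ≠ j → fQ a α0 k x = 0) :
    (schurEnt (radius a α0) (cdist a) (univ.erase j) Lbl.star (Lbl.idx j) + fQ a α0 j x) ^ 2 =
      schurEnt (radius a α0) (cdist a) (univ.erase j) Lbl.star Lbl.star *
        schurEnt (radius a α0) (cdist a) (univ.erase j) (Lbl.idx j) (Lbl.idx j) := by
  have hzero : B0s (fun k => dist (-x) (a k)) (cdist a) univ = 0 := by
    refine B0s_dist_eq_zero a (-x) univ fun hind => ?_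
    have := hind.card_le_finrank_succ
    have hle := (vectorSpan ℝ (Set.range (Fin.cons (-x) (fun i => a
      ((univ : Finset (Fin (n + 1))).orderEmbOfFin rfl i)) :
      Fin ((univ : Finset (Fin (n + 1))).card + 1) → EuclideanSpace ℝ (Fin n)))).finrank_le
    simp only [Fintype.card_fin, card_univ, finrank_euclideanSpace_fin] at this hle
    omega
  have hcongr := schurEnt_congr (radius a α0) (fun k => dist (-x) (a k)) (cdist a)
    (univ.erase j) (fun k hk => by
      rw [fQ_eq_dist_sq a α0 hrad, hx k (ne_of_mem_erase hk), add_zero])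
  rw [B0s_univ_eq_schurEnt _ _ (cdist_comm a) j (by rwa [B0_congr (radius a α0)]),
    B0_congr (radius a α0)] at hzero
  have hS := (mul_eq_zero.mp hzero).resolve_left h
  simp only [hcongr, ent, fQ_eq_dist_sq a α0 hrad] at hS
  linear_combination -hS

/-- The spheres `S_k`, `k ≠ j`, do not meet in the hyperplane of their centers. -/
theorem exists_inner_ne_zero (hrad : ∀ j, 0 < ‖a j‖ ^ 2 - α0 j) (j : Fin (n + 1))
    (h : B0 (radius a α0) (cdist a) (univ.erase j) ≠ 0)
    (hs : B0s (radius a α0) (cdist a) (univ.erase j) ≠ 0) (x : EuclideanSpace ℝ (Fin n))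
    (hx : ∀ k, k ≠ j → fQ a α0 k x = 0) {u : EuclideanSpace ℝ (Fin n)} (hu : u ≠ 0) :
    ∃ k, k ≠ j ∧ inner ℝ (x + a k) u ≠ 0 := by
  by_contra! hcon
  have hcongr := schurEnt_congr (radius a α0) (fun k => dist (-x) (a k)) (cdist a)
    (univ.erase j) (fun k hk => by
      rw [fQ_eq_dist_sq a α0 hrad, hx k (ne_of_mem_erase hk), add_zero])
  apply hs
  rw [B0s_eq_schurEnt _ _ _ h, ← B0_congr (radius a α0) (fun k => dist (-x) (a k))]
  have hstar := hcongr Lbl.star Lbl.star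
  simp only [ent, sub_zero, add_zero] at hstar
  rw [← hstar, ← B0s_eq_schurEnt _ _ _ (by rwa [B0_congr (radius a α0)])]
  refine B0s_dist_eq_zero a (-x) _ fun hind => hu ?_
  have hcard : (univ.erase j).card + 1 = n + 1 := by simp
  have hinner : ∀ i, inner ℝ ((Fin.cons (-x) (fun i => a ((univ.erase j).orderEmbOfFin rfl i)) :
      Fin ((univ.erase j).card + 1) → EuclideanSpace ℝ (Fin n)) i + x) u = 0 := by
    intro i
    refine Fin.cases (by simp) (fun i => ?_) i
    rw [Fin.cons_succ, add_comm]
    exact hcon _ (ne_of_mem_erase ((univ.erase j).orderEmbOfFin_mem rfl i))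
  refine eq_zero_of_inner_sub_eq_zero
    ((affineIndependent_equiv (finCongr hcard.symm)).mpr hind) fun i k => ?_
  rw [← add_sub_add_right_eq_sub _ _ x, inner_sub_left]
  exact sub_eq_zero.mpr ((hinner _).trans (hinner _).symm)

/-- A point is determined by the values of all `f_k`. -/
theorem eq_of_fQ_eq (ha : AffineIndependent ℝ a) {x y : EuclideanSpace ℝ (Fin n)}
    (h : ∀ k, fQ a α0 k x = fQ a α0 k y) : x = y := by
  refine sub_eq_zero.mp (eq_zero_of_inner_sub_eq_zero ha fun i k => ?_)
  have hi := h i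
  have hk := h k
  simp only [fQ] at hi hk
  simp only [inner_sub_left, inner_sub_right]
  linarith

end Spheres

theorem eq_of_add_sq_eq {s y y' : ℝ} (h : (s + y') ^ 2 = (s + y) ^ 2) (hne : y' ≠ y) :
    y' = -2 * s - y := by
  have hmul : (y' - y) * (2 * s + y + y') = 0 := by linear_combination h
  have := (mul_eq_zero.mp hmul).resolve_left (sub_ne_zero.mpr hne)
  linarith

/-- Signs and values of two numbers `y ≤ 0` and `y' ≠ y` with `(s + y)² = (s + y')² = t w`. -/
theorem inv_values_of_sq_eq {e d s t w y y' : ℝ} (he : e = 1 ∨ e = -1) (hd : 0 < e * d)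
    (hB : 0 < e * (d * (t * w - s ^ 2))) (hy : (s + y) ^ 2 = t * w) (hy' : (s + y') ^ 2 = t * w)
    (hne : y' ≠ y) (hle : y ≤ 0) :
    y < 0 ∧ 0 < y' ∧
      y⁻¹ = (-e * √(d * t * (d * w)) + d * s) / (d * (t * w - s ^ 2)) ∧
      y'⁻¹ = (e * √(d * t * (d * w)) + d * s) / (d * (t * w - s ^ 2)) ∧
      y⁻¹ * y'⁻¹ = -d / (d * (t * w - s ^ 2)) := by
  have hd0 : d ≠ 0 := by rintro rfl; simp at hd
  have he2 : e * e = 1 := by rcases he with rfl | rfl <;> norm_num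
  have hg : 0 < t * w - s ^ 2 := by
    have hprod := mul_pos hd hB
    have hrw : e * d * (e * (d * (t * w - s ^ 2))) = d ^ 2 * (t * w - s ^ 2) := by
      linear_combination (d ^ 2 * (t * w - s ^ 2)) * he2
    rw [hrw] at hprod
    exact pos_of_mul_pos_right hprod (sq_nonneg d)
  have hsum : y' = -2 * s - y := eq_of_add_sq_eq (hy'.trans hy.symm) hne
  have hyy : y * y' = -(t * w - s ^ 2) := by rw [hsum]; linear_combination -hy
  have hy0 : y < 0 := by
    refine lt_of_le_of_ne hle ?_
    rintro rfl
    linarith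
  have hy'0 : 0 < y' := by nlinarith
  have hsq : √(d * t * (d * w)) = e * d * (s + y') := by
    have : d * t * (d * w) = (e * d * (s + y')) ^ 2 := by
      rw [mul_pow, mul_pow, sq e, he2, hy']
      ring
    rw [this, Real.sqrt_sq]
    exact mul_nonneg hd.le (by linarith)
  have hgy : t * w - s ^ 2 = -(y * y') := by linarith
  have hyne := hy0.ne
  have hyne' := hy'0.ne'
  refine ⟨hy0, hy'0, ?_, ?_, ?_⟩
  · rw [hsq, hgy, eq_div_iff (by simp [hd0, hyne, hyne'])]
    field_simp
    linear_combination (s + y') * he2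
  · rw [hsq, hgy, eq_div_iff (by simp [hd0, hyne, hyne'])]
    field_simp
    linear_combination -(s + y') * he2 - hsum
  · rw [hgy]
    field_simp

/-- **Proposition 6**: the values of `1/f_j` at the two points of `⋂_{k≠j} S_k`. -/
theorem values_at_vertices
    (n : ℕ) (hn : 2 ≤ n)
    (a : Fin (n + 1) → EuclideanSpace ℝ (Fin n)) (α0 : Fin (n + 1) → ℝ)
    (hrad : ∀ j, 0 < ‖a j‖ ^ 2 - α0 j)
    (hH1 : H1 (radius a α0) (cdist a))
    (htri : Triangular a) (hdiag : DiagPos a)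
    (hD : (interior (Dm a α0)).Nonempty)
    (P : Fin (n + 1) → EuclideanSpace ℝ (Fin n))
    (hPsph : ∀ j, ∀ k, k ≠ j → fQ a α0 k (P j) = 0)
    (hPbd : ∀ j, P j ∈ frontier (Dm a α0))
    (hPuniq : ∀ j x, (∀ k, k ≠ j → fQ a α0 k x = 0) → x ∈ frontier (Dm a α0) → x = P j)
    (hH2 : H2 P)
    (j : Fin (n + 1)) :
    ∃ P' : EuclideanSpace ℝ (Fin n), P' ≠ P j ∧
      {x | ∀ k, k ≠ j → fQ a α0 k x = 0} = {P j, P'} ∧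
      fQ a α0 j (P j) ≠ 0 ∧ fQ a α0 j P' ≠ 0 ∧
      (fQ a α0 j (P j))⁻¹ =
        ((-1 : ℝ) ^ (n + 1) *
            Real.sqrt (B0s (radius a α0) (cdist a) (Finset.univ.erase j) *
              B0 (radius a α0) (cdist a) (Finset.univ : Finset (Fin (n + 1)))) +
          Bmix (radius a α0) (cdist a) j (Finset.univ.erase j)) /
          B0s (radius a α0) (cdist a) (Finset.univ : Finset (Fin (n + 1))) ∧
      (fQ a α0 j (P j))⁻¹ < 0 ∧
      (fQ a α0 j P')⁻¹ =
        ((-1 : ℝ) ^ n *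
            Real.sqrt (B0s (radius a α0) (cdist a) (Finset.univ.erase j) *
              B0 (radius a α0) (cdist a) (Finset.univ : Finset (Fin (n + 1)))) +
          Bmix (radius a α0) (cdist a) j (Finset.univ.erase j)) /
          B0s (radius a α0) (cdist a) (Finset.univ : Finset (Fin (n + 1))) ∧
      0 < (fQ a α0 j P')⁻¹ ∧
      (fQ a α0 j (P j))⁻¹ * (fQ a α0 j P')⁻¹ =
        - B0 (radius a α0) (cdist a) (Finset.univ.erase j) /
          B0s (radius a α0) (cdist a) (Finset.univ : Finset (Fin (n + 1))) ∧
      (fQ a α0 j (P j))⁻¹ * (fQ a α0 j P')⁻¹ < 0 := by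
  have hn0 : 0 < n := by omega
  have hcard : (univ.erase j : Finset (Fin (n + 1))).card = n := by simp
  have hK : (univ.erase j : Finset (Fin (n + 1))).Nonempty := card_pos.mp (by omega)
  obtain ⟨hd, hsK⟩ := hH1 _ hK
  obtain ⟨hN, hsN⟩ := hH1 univ univ_nonempty
  rw [hcard] at hd hsK
  rw [card_univ, Fintype.card_fin] at hN hsN
  have hd0 := right_ne_zero_of_mul hd.ne'
  have hsK0 := right_ne_zero_of_mul hsK.ne'
  have ha := affineIndependent_of_B0_ne_zero a _ (right_ne_zero_of_mul hN.ne')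
  have hquad := sq_schurEnt_add_fQ a α0 hrad j hd0
  obtain ⟨u, hu, hperp⟩ := exists_ne_zero_inner_sub_eq_zero a hn0 j
  obtain ⟨k₀, hk₀, hinner⟩ := exists_inner_ne_zero a α0 hrad j hd0 hsK0 (P j) (hPsph j) hu
  have hu2 : ‖u‖ ^ 2 ≠ 0 := pow_ne_zero 2 (norm_ne_zero_iff.mpr hu)
  set t : ℝ := -(2 * inner ℝ (P j + a k₀) u) / ‖u‖ ^ 2 with ht
  have ht0 : t ≠ 0 := div_ne_zero (neg_ne_zero.mpr (mul_ne_zero two_ne_zero hinner)) hu2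
  have hP' : ∀ k, k ≠ j → fQ a α0 k (P j + t • u) = 0 := by
    intro k hk
    have hkk := hperp k k₀ hk hk₀
    rw [inner_sub_left, sub_eq_zero] at hkk
    rw [fQ_add_smul, hPsph j k hk, inner_add_left, hkk, ← inner_add_left, ht,
      div_mul_cancel₀ _ hu2]
    ring
  have hPne : P j + t • u ≠ P j := by simp [ht0, hu]
  have hfne : ∀ x y, (∀ k, k ≠ j → fQ a α0 k x = 0) → (∀ k, k ≠ j → fQ a α0 k y = 0) →
      fQ a α0 j x = fQ a α0 j y → x = y := by
    intro x y hx hy hxy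
    refine eq_of_fQ_eq a α0 ha fun k => ?_
    by_cases hk : k = j
    · rw [hk, hxy]
    · rw [hx k hk, hy k hk]
  have hclosed : IsClosed (Dm a α0) := by
    have : Dm a α0 = ⋂ k, {x | fQ a α0 k x ≤ 0} := by ext; simp [Dm]
    rw [this]
    refine isClosed_iInter fun k => isClosed_le ?_ continuous_const
    unfold fQ
    fun_prop
  have hle : fQ a α0 j (P j) ≤ 0 := hclosed.frontier_subset (hPbd j) j
  have hyne : fQ a α0 j (P j + t • u) ≠ fQ a α0 j (P j) :=
    fun h => hPne (hfne _ _ hP' (hPsph j) h)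
  have hBN := B0s_univ_eq_schurEnt (radius a α0) (cdist a) (cdist_comm a) j hd0
  rw [pow_succ, pow_succ, mul_assoc, mul_assoc, hBN] at hsN
  obtain ⟨hneg, hpos, hinv, hinv', hprod⟩ := inv_values_of_sq_eq
    (neg_one_pow_eq_or ℝ n) hd (by simpa using hsN) (hquad _ (hPsph j)) (hquad _ hP') hyne hle
  rw [B0s_eq_schurEnt _ _ _ hd0, B0_univ_eq_schurEnt _ _ j hd0, Bmix_eq_schurEnt _ _ _ hd0, hBN]
  refine ⟨P j + t • u, hPne, ?_, hneg.ne, hpos.ne', ?_, inv_lt_zero.mpr hneg, hinv',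
    inv_pos.mpr hpos, hprod, mul_neg_of_neg_of_pos (inv_lt_zero.mpr hneg) (inv_pos.mpr hpos)⟩
  · ext x
    constructor
    · intro hx
      have h1 := hquad x hx
      have h2 := hquad _ (hPsph j)
      have h3 := hquad _ hP'
      by_cases hxP : fQ a α0 j x = fQ a α0 j (P j)
      · exact Or.inl (hfne _ _ hx (hPsph j) hxP)
      · refine Or.inr (hfne _ _ hx hP' ?_)
        rw [eq_of_add_sq_eq (h1.trans h2.symm) hxP, eq_of_add_sq_eq (h3.trans h2.symm) hyne]
    · rintro (rfl | rfl)
      · exact hPsph j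
      · exact hP'
  · rw [hinv, pow_succ (-1 : ℝ) n, mul_neg_one]

end SchlafliVol
end

section
/- Let n ≥ 2 and suppose the quadratic polynomials are in normalized triangular form with α_{j,n+1−j}>0 for 1≤j≤n. Then for every 1 ≤ p ≤ n: ∏_{j=p}^{n} α_{j,n+1−j} = √( (−1)^{n−p} · B(0 {p, p+1, …, n, n+1}) / 2^{n−p+1} ). -/
open MeasureTheory Metric Finset
open scoped BigOperators

namespace SchlafliVol

variable {m : ℕ}

variable {n : ℕ}

/-- A Cayley–Menger determinant of `k + 1` points of `ℝᵏ` in triangular position. -/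
lemma det_cayleyMenger_of_triangular {k : ℕ} (x : Fin (k + 1) → Fin k → ℝ)
    (hx : ∀ i c, c.castSucc < i → x i c = 0)
    (M : Matrix (Fin (k + 2)) (Fin (k + 2)) ℝ) (h00 : M 0 0 = 0)
    (h0 : ∀ j : Fin (k + 1), M 0 j.succ = 1) (h1 : ∀ i : Fin (k + 1), M i.succ 0 = 1)
    (hM : ∀ i j : Fin (k + 1), M i.succ j.succ = ∑ c, (x i c - x j c) ^ 2) :
    M.det = -(-2) ^ k * (∏ i : Fin k, x i.castSucc i) ^ 2 := by
  let P : Matrix (Fin (k + 2)) (Fin (k + 2)) ℝ :=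
    Matrix.of (Fin.cons (Fin.cons 1 0)
      (fun i : Fin (k + 1) => Fin.cons (∑ c, x i c ^ 2) (Fin.snoc (x i) 1)))
  let d : Fin (k + 2) → ℝ := Fin.cons 1 (Fin.snoc (fun _ : Fin k => (-2 : ℝ)) 1)
  let σ : Equiv.Perm (Fin (k + 2)) := Equiv.swap 0 (Fin.last (k + 1))
  have hσl : σ (Fin.last k).succ = 0 := by simp [σ, Fin.succ_last]
  have hσ0 : σ 0 = (Fin.last k).succ := by simp [σ, Fin.succ_last]
  have hσm : ∀ c : Fin k, σ c.castSucc.succ = c.castSucc.succ := by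
    intro c
    refine Equiv.swap_apply_of_ne_of_ne (Fin.succ_ne_zero _) ?_
    rw [← Fin.succ_last]
    simp
  have hfac : M = P * ((Matrix.diagonal d * P.transpose).submatrix σ id) := by
    ext i j
    rw [Matrix.mul_apply, Fin.sum_univ_succ, Fin.sum_univ_castSucc]
    simp only [Matrix.submatrix_apply, hσl, hσ0, hσm, Matrix.diagonal_mul,
      Matrix.transpose_apply, id]
    cases i using Fin.cases with
    | zero =>
      cases j using Fin.cases with
      | zero => simp [P, d, h00]
      | succ j => simp [P, d, h0]
    | succ i =>
      cases j using Fin.cases with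
      | zero => simp [P, d, h1]
      | succ j =>
        simp only [hM, P, d, Matrix.of_apply, Fin.cons_succ, Fin.cons_zero, Fin.snoc_castSucc,
          Fin.snoc_last]
        rw [one_mul, one_mul, mul_one, one_mul, ← Finset.sum_add_distrib,
          ← Finset.sum_add_distrib]
        exact Finset.sum_congr rfl fun c _ => by ring
  have hP : P.det = ∏ i : Fin k, x i.castSucc i := by
    rw [Matrix.det_succ_row_zero, Fin.sum_univ_succ]
    have hup : (P.submatrix Fin.succ (Fin.succAbove 0)).BlockTriangular id := by
      intro i j hij
      cases j using Fin.lastCases with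
      | last => exact absurd hij (Fin.le_last i).not_gt
      | cast c => simpa [P] using hx i c hij
    rw [Matrix.det_of_isUpperTriangular hup, Fin.prod_univ_castSucc]
    simp [P]
  have hd : (Matrix.diagonal d).det = (-2) ^ k := by
    rw [Matrix.det_diagonal, Fin.prod_univ_succ, Fin.prod_univ_castSucc]
    simp [d]
  have hsign : (Equiv.Perm.sign σ : ℤ) = -1 := by
    have : (0 : Fin (k + 2)) ≠ Fin.last (k + 1) := (Fin.last_pos).ne
    simp [σ, Equiv.Perm.sign_swap this]
  rw [hfac, Matrix.det_mul, Matrix.det_permute, Matrix.det_mul, Matrix.det_transpose, hP, hd,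
    hsign]
  push_cast
  ring

lemma B0_eq_Bdet {m k : ℕ} (rad : Fin m → ℝ) (ρ : Fin m → Fin m → ℝ) (J : Finset (Fin m))
    (hJ : J.card = k) (e : Fin k → Fin m) (he : StrictMono e) (hmem : ∀ i, e i ∈ J) :
    B0 rad ρ J = Bdet rad ρ (Fin.cons Lbl.zero fun i => Lbl.idx (e i))
      (Fin.cons Lbl.zero fun i => Lbl.idx (e i)) := by
  subst hJ
  rw [Finset.orderEmbOfFin_unique rfl hmem he]
  rfl

/-- `B(0 J)` for a terminal segment `J` of indices, in terms of the diagonal coefficients. -/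
lemma B0_tail_of_triangular {k q : ℕ}
    (a : Fin (k + q + 1) → EuclideanSpace ℝ (Fin (k + q))) (rad : Fin (k + q + 1) → ℝ)
    (htri : Triangular a) :
    B0 rad (cdist a) (Finset.univ.filter (fun j : Fin (k + q + 1) => q ≤ (j : ℕ))) =
      -(-2) ^ k * (∏ i : Fin k, a ⟨q + i, by omega⟩ ⟨k - i - 1, by omega⟩) ^ 2 := by
  let e : Fin (k + 1) → Fin (k + q + 1) := fun i => ⟨q + i, by omega⟩
  have he : StrictMono e := fun i j hij => by
    simpa [e] using hij
  have hJ : Finset.univ.filter (fun j : Fin (k + q + 1) => q ≤ (j : ℕ)) =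
      Finset.univ.map ⟨e, he.injective⟩ := by
    ext j
    simp only [Finset.mem_filter, Finset.mem_univ, true_and, Finset.mem_map,
      Function.Embedding.coeFn_mk]
    refine ⟨fun h => ⟨⟨j - q, by omega⟩, Fin.ext (by simp only [e]; omega)⟩, ?_⟩
    rintro ⟨i, rfl⟩
    simp [e]
  rw [hJ, B0_eq_Bdet rad (cdist a) _ (by simp) e he (by simp), Bdet,
    det_cayleyMenger_of_triangular (fun i c => a (e i) (Fin.castAdd q c.rev))]
  · rfl
  · intro i c hic
    refine htri _ _ ?_
    simp only [Fin.lt_def, Fin.val_castSucc] at hic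
    simp only [e, Fin.val_castAdd, Fin.val_rev]
    omega
  · simp [ent]
  · simp [ent]
  · simp [ent]
  · intro i j
    have hz : ∀ (i : Fin (k + 1)) (c : Fin q), a (e i) (Fin.natAdd k c) = 0 := fun i c =>
      htri _ _ (by simp only [e, Fin.val_natAdd]; omega)
    simp only [Matrix.of_apply, Fin.cons_succ, ent, cdist, EuclideanSpace.dist_eq]
    rw [Real.sq_sqrt (Finset.sum_nonneg fun _ _ => sq_nonneg _), Fin.sum_univ_add]
    simp only [hz, dist_self, Real.dist_eq, sq_abs]
    rw [← Equiv.sum_comp Fin.revPerm]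
    simp

/-- The identity `∏_{j=p}^{n} α_{j,n+1-j} = √((-1)^{n-p} B(0 p … n n+1)/2^{n-p+1})`
(1-based paper indices; here the index `j : Fin (n+1)` corresponds to the paper index
`j+1`, and the coordinate `ν : Fin n` to the paper coordinate `ν+1`). -/
theorem prod_diagonal_coefficients
    (n : ℕ) (hn : 2 ≤ n)
    (a : Fin (n + 1) → EuclideanSpace ℝ (Fin n)) (α0 : Fin (n + 1) → ℝ)
    (hrad : ∀ j, 0 < ‖a j‖ ^ 2 - α0 j)
    (htri : Triangular a) (hdiag : DiagPos a)
    (p : ℕ) (hp : 1 ≤ p) (hpn : p ≤ n) :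
    ∏ j ∈ Finset.univ.filter (fun j : Fin (n + 1) => p - 1 ≤ (j : ℕ) ∧ (j : ℕ) < n),
        a j ⟨n - (j : ℕ) - 1, by omega⟩ =
      Real.sqrt ((-1 : ℝ) ^ (n - p) *
          B0 (radius a α0) (cdist a)
            (Finset.univ.filter (fun j : Fin (n + 1) => p - 1 ≤ (j : ℕ))) /
        2 ^ (n - p + 1)) := by
  obtain ⟨q, rfl⟩ : ∃ q, p = q + 1 := ⟨p - 1, by omega⟩
  obtain ⟨k, rfl⟩ : ∃ k, n = k + q := ⟨n - q, by omega⟩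
  have hprod : ∏ j ∈ Finset.univ.filter
        (fun j : Fin (k + q + 1) => q + 1 - 1 ≤ (j : ℕ) ∧ (j : ℕ) < k + q),
        a j ⟨k + q - (j : ℕ) - 1, by omega⟩ =
      ∏ i : Fin k, a ⟨q + i, by omega⟩ ⟨k - i - 1, by omega⟩ := by
    symm
    refine Finset.prod_bij (fun i _ => ⟨q + i, by omega⟩) ?_ ?_ ?_ ?_
    · intro i _
      simp only [Finset.mem_filter, Finset.mem_univ, true_and]
      omega
    · intro i _ j _ hij
      simp only [Fin.mk.injEq] at hij
      omega
    · intro j hj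
      simp only [Finset.mem_filter, Finset.mem_univ, true_and] at hj
      exact ⟨⟨j - q, by omega⟩, Finset.mem_univ _, Fin.ext (by simp only; omega)⟩
    · intro i _
      refine congrArg _ (Fin.ext ?_)
      simp only
      omega
  have hpos : 0 ≤ ∏ i : Fin k, a ⟨q + i, by omega⟩ ⟨k - i - 1, by omega⟩ :=
    Finset.prod_nonneg fun i _ => (hdiag _ _ (by simp only; omega) (by simp only; omega)).le
  obtain ⟨l, rfl⟩ : ∃ l, k = l + 1 := ⟨k - 1, by omega⟩
  have hl : l + 1 + q - (q + 1) = l := by omega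
  have hsq : ∀ t : ℝ, (-1) ^ l * (-(-2) ^ (l + 1) * t ^ 2) / 2 ^ (l + 1) = t ^ 2 := by
    intro t
    have hone : ((-1 : ℝ) ^ l) * (-1) ^ l = 1 := by rw [← mul_pow]; simp
    rw [neg_pow (2 : ℝ), pow_succ (-1 : ℝ), div_eq_iff (by positivity)]
    linear_combination (t ^ 2 * 2 ^ (l + 1)) * hone
  simp only [Nat.add_sub_cancel] at hprod ⊢
  rw [hprod, B0_tail_of_triangular a _ htri, hl, hsq, Real.sqrt_sq hpos]

end SchlafliVol
end

section
/- Let n ≥ 2 and suppose the quadratic polynomials are in normalized triangular form with α_{j,n+1−j}>0 for 1≤j≤n. Then for every x∈ℝⁿ, the determinant of the n×n Jacobian matrix (∂f_j/∂x_ν(x))_{2≤j≤n+1, 1≤ν≤n} equals 2^n · (−1)^{(n−1)(n−2)/2} · (∏_{j=2}^{n} α_{j,n+1−j}) · x_n. -/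
open MeasureTheory Metric Finset
open scoped BigOperators

namespace SchlafliVol

variable {m : ℕ}

variable {n : ℕ}

/-- The determinant of a matrix vanishing below its antidiagonal. -/
theorem det_of_antitriangular {R : Type*} [CommRing R] :
    ∀ {k : ℕ} (A : Matrix (Fin k) (Fin k) R),
      (∀ i j : Fin k, k ≤ (i : ℕ) + j → A i j = 0) →
      A.det = (-1) ^ (k * (k - 1) / 2) * ∏ i, A i i.rev
  | 0, A, _ => by simp
  | k + 1, A, hA => by
    rw [Matrix.det_succ_column A (Fin.last k), Fin.sum_univ_succ, Finset.sum_eq_zero, add_zero,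
      det_of_antitriangular (A.submatrix (Fin.succAbove 0) (Fin.last k).succAbove),
      Fin.prod_univ_succ]
    · have hexp : (k + 1) * (k + 1 - 1) / 2 = k + k * (k - 1) / 2 := by
        rw [← Nat.choose_two_right, ← Nat.choose_two_right, Nat.choose_succ_succ' k 1,
          Nat.choose_one_right]
      rw [hexp, pow_add]
      simp only [Matrix.submatrix_apply, Fin.succAbove_zero, Fin.succAbove_last, Fin.rev_succ,
        Fin.rev_zero, Fin.val_zero, Fin.val_last]
      ring
    · intro i j hij
      apply hA
      simp only [Fin.succAbove_zero, Fin.succAbove_last, Fin.val_succ, Fin.val_castSucc]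
      omega
    · intro i _
      rw [hA i.succ (Fin.last k) (by simp only [Fin.val_succ, Fin.val_last]; omega)]
      simp

/-- The partial derivatives of `fQ`. -/
theorem fderiv_fQ_single (a : Fin (n + 1) → EuclideanSpace ℝ (Fin n)) (α0 : Fin (n + 1) → ℝ)
    (j : Fin (n + 1)) (x : EuclideanSpace ℝ (Fin n)) (ν : Fin n) :
    fderiv ℝ (fQ a α0 j) x (EuclideanSpace.single ν (1 : ℝ)) = 2 * (x ν + a j ν) := by
  have h : HasFDerivAt (fQ a α0 j) (2 • innerSL ℝ x + (2 : ℝ) • innerSL ℝ (a j)) x :=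
    (((hasStrictFDerivAt_norm_sq x).hasFDerivAt).add
      ((innerSL ℝ (a j)).hasFDerivAt.const_mul 2)).add_const _
  rw [h.fderiv]
  simp [EuclideanSpace.inner_single_right]
  ring

/-- The Jacobian determinant of `(f_2, …, f_{n+1})`: for all `x`,
`det(∂f_j/∂x_ν) = 2^n (-1)^{(n-1)(n-2)/2} (∏_{j=2}^n α_{j,n+1-j}) x_n`
(the row `j : Fin n` corresponds to the paper index `j+2`). -/
theorem jacobian_det_triangular
    (n : ℕ) (hn : 2 ≤ n)
    (a : Fin (n + 1) → EuclideanSpace ℝ (Fin n)) (α0 : Fin (n + 1) → ℝ)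
    (htri : Triangular a) (hdiag : DiagPos a)
    (x : EuclideanSpace ℝ (Fin n)) :
    Matrix.det (Matrix.of fun (j : Fin n) (ν : Fin n) =>
        fderiv ℝ (fQ a α0 (Fin.succ j)) x (EuclideanSpace.single ν (1 : ℝ))) =
      2 ^ n * (-1 : ℝ) ^ ((n - 1) * (n - 2) / 2) *
        (∏ i ∈ Finset.univ.filter (fun i : Fin (n + 1) => 1 ≤ (i : ℕ) ∧ (i : ℕ) < n),
          a i ⟨n - (i : ℕ) - 1, by omega⟩) *
        x ⟨n - 1, by omega⟩ := by
  obtain ⟨m, rfl⟩ : ∃ m, n = m + 1 := ⟨n - 1, by omega⟩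
  simp only [fderiv_fQ_single]
  have hlast : ∀ ν, a (Fin.last (m + 1)) ν = 0 := fun ν => htri _ _ (by simp)
  rw [Matrix.det_eq_of_forall_row_eq_smul_add_const
    (B := Matrix.of fun (j ν : Fin (m + 1)) =>
      2 * if j = Fin.last m then x ν else a j.succ ν)
    (fun j => if j = Fin.last m then 0 else 1) (Fin.last m) (by simp)
    (by
      intro i j
      by_cases hi : i = Fin.last m
      · subst hi
        simp [hlast]
      · simp [hi]
        ring)]
  rw [Matrix.det_succ_column _ (Fin.last m), Fin.sum_univ_castSucc, Finset.sum_eq_zero, zero_add,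
    det_of_antitriangular]
  · rw [Finset.prod_filter, Fin.prod_univ_succ, Fin.prod_univ_castSucc]
    have hidx : ∀ i : Fin m, (⟨m - i - 1, by omega⟩ : Fin (m + 1))
        = i.rev.castSucc := fun i => Fin.ext (by simp [Fin.val_rev]; omega)
    simp [Finset.prod_mul_distrib, hidx, Fin.castSucc_ne_last, ← two_mul]
    rw [show (⟨m, by omega⟩ : Fin (m + 1)) = Fin.last m from rfl]
    ring
  · intro i j hij
    have h := htri i.castSucc.succ j.castSucc (by simp; omega)
    simp [h, Fin.castSucc_ne_last]
  · intro i _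
    have h := htri i.castSucc.succ (Fin.last m) (by simp)
    simp [h, Fin.castSucc_ne_last]

end SchlafliVol
end

section
/- Let n = 2 and suppose three circles S_1, S_2, S_3 in ℝ² (centers O_j, radii r_j, mutual center distances ρ_{jk}) satisfy (H1) and (H2), so that D = ⋂_{j=1}^3 {f_j ≤ 0} is the pseudo-triangle with circular-arc sides. For each j let φ_j ∈ (0, π) be the angle of the triangle O_1O_2O_3 at O_j (cos φ_j = (ρ_{jk}² + ρ_{jl}² − ρ_{kl}²)/(2ρ_{jk}ρ_{jl}) for {j,k,l}={1,2,3}), and for j≠k let ψ_{jk} ∈ (0, 2π) be given by cos(ψ_{jk}/2) = (r_j² + ρ_{jk}² − r_k²)/(2ρ_{jk} r_j) with ψ_{jk}/2 ∈ (0,π). Then area(D) = area(Δ O_1O_2O_3) − Σ_{j=1}^{3} (1/2) r_j² φ_j + Σ_{1≤j<k≤3} ( (1/4) r_j² (ψ_{jk} − sin ψ_{jk}) + (1/4) r_k² (ψ_{kj} − sin ψ_{kj}) ), where area denotes 2-dimensional Lebesgue measure and Δ O_1O_2O_3 is the convex hull of the three centers. -/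
open MeasureTheory Metric Finset
open scoped BigOperators

namespace SchlafliVol

variable {m : ℕ}

variable {n : ℕ}

section PlaneGeometry

open Complex Real

/-- Twice the signed area of the triangle `A B z`. -/
def side (A B z : ℂ) : ℝ := (B.re - A.re) * (z.im - A.im) - (B.im - A.im) * (z.re - A.re)

/-- The power of `z` with respect to the circle with center `A` and radius `r`. -/
def power (A : ℂ) (r : ℝ) (z : ℂ) : ℝ := (z.re - A.re) ^ 2 + (z.im - A.im) ^ 2 - r ^ 2

/-- The closed triangle with positively oriented vertices `A`, `B`, `C`. -/
def tri (A B C : ℂ) : Set ℂ := {z | 0 ≤ side B C z ∧ 0 ≤ side C A z ∧ 0 ≤ side A B z}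

/-- The part of the disc with center `A` and radius `r` in the angle `B A C`. -/
def sector (A B C : ℂ) (r : ℝ) : Set ℂ :=
  {z | power A r z ≤ 0 ∧ 0 ≤ side A B z ∧ 0 ≤ side C A z}

/-- The part of the lens of two discs to the left of the line through their centers. -/
def halfLens (A B : ℂ) (p q : ℝ) : Set ℂ :=
  {z | power A p z ≤ 0 ∧ power B q z ≤ 0 ∧ 0 ≤ side A B z}

/-- The intersection of three discs. -/
def discInter (A B C : ℂ) (p q r : ℝ) : Set ℂ :=
  {z | power A p z ≤ 0 ∧ power B q z ≤ 0 ∧ power C r z ≤ 0}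

lemma continuous_side (A B : ℂ) : Continuous (side A B) := by unfold side; fun_prop

lemma continuous_power (A : ℂ) (r : ℝ) : Continuous (power A r) := by unfold power; fun_prop

lemma measurableSet_tri (A B C : ℂ) : MeasurableSet (tri A B C) :=
  ((isClosed_le continuous_const (continuous_side B C)).inter
    ((isClosed_le continuous_const (continuous_side C A)).inter
      (isClosed_le continuous_const (continuous_side A B)))).measurableSet

lemma measurableSet_sector (A B C : ℂ) (r : ℝ) : MeasurableSet (sector A B C r) :=
  ((isClosed_le (continuous_power A r) continuous_const).inter
    ((isClosed_le continuous_const (continuous_side A B)).inter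
      (isClosed_le continuous_const (continuous_side C A)))).measurableSet

lemma measurableSet_halfLens (A B : ℂ) (p q : ℝ) : MeasurableSet (halfLens A B p q) :=
  ((isClosed_le (continuous_power A p) continuous_const).inter
    ((isClosed_le (continuous_power B q) continuous_const).inter
      (isClosed_le continuous_const (continuous_side A B)))).measurableSet

lemma measurableSet_discInter (A B C : ℂ) (p q r : ℝ) : MeasurableSet (discInter A B C p q r) :=
  ((isClosed_le (continuous_power A p) continuous_const).inter
    ((isClosed_le (continuous_power B q) continuous_const).inter
      (isClosed_le (continuous_power C r) continuous_const))).measurableSet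

lemma power_nonpos_subset_closedBall (A : ℂ) (r : ℝ) :
    {z | power A r z ≤ 0} ⊆ closedBall A |r| := by
  intro z hz
  have hz' : power A r z ≤ 0 := hz
  rw [mem_closedBall, dist_eq_norm, Complex.norm_eq_sqrt_sq_add_sq]
  apply Real.sqrt_le_iff.2 ⟨abs_nonneg r, ?_⟩
  simp only [power, sub_re, sub_im, sq_abs] at hz' ⊢
  linarith

lemma volume_ne_top_of_subset_power {A : ℂ} {r : ℝ} {s : Set ℂ}
    (h : s ⊆ {z | power A r z ≤ 0}) : volume s ≠ ⊤ :=
  ((measure_mono (h.trans (power_nonpos_subset_closedBall A r))).trans_lt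
    measure_closedBall_lt_top).ne

lemma volume_real_eq_zero_of_subset_power {A : ℂ} {s : Set ℂ}
    (h : s ⊆ {z | power A 0 z ≤ 0}) : volume.real s = 0 := by
  have hs : s ⊆ {A} := by
    simpa using h.trans (power_nonpos_subset_closedBall A 0)
  rw [measureReal_def, measure_mono_null hs (measure_singleton A), ENNReal.toReal_zero]

/-- A direct isometry of the plane preserves areas. -/
lemma measurePreserving_add_mul (A u : ℂ) (hu : ‖u‖ = 1) :
    MeasurePreserving (fun z : ℂ => A + u * z) := by
  let c : Circle := ⟨u, by simpa [Submonoid.unitSphere] using hu⟩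
  exact (measurePreserving_add_left volume A).comp (rotation c).measurePreserving

lemma volume_real_preimage_add_mul (A u : ℂ) (hu : ‖u‖ = 1) {s : Set ℂ}
    (hs : MeasurableSet s) : volume.real ((fun z : ℂ => A + u * z) ⁻¹' s) = volume.real s := by
  rw [measureReal_def, (measurePreserving_add_mul A u hu).measure_preimage hs.nullMeasurableSet,
    measureReal_def]

/-- The area of the circular sector of radius `r` and angle `φ` along the positive real axis. -/
lemma volume_real_sector_aux {r φ : ℝ} (hr : 0 ≤ r) (h0 : 0 < φ) (hπ : φ < π) :
    volume.real {z : ℂ | z.re ^ 2 + z.im ^ 2 ≤ r ^ 2 ∧ 0 ≤ z.im ∧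
      0 ≤ z.re * Real.sin φ - z.im * Real.cos φ} = 1 / 2 * r ^ 2 * φ := by
  set S : Set ℂ := {z : ℂ | z.re ^ 2 + z.im ^ 2 ≤ r ^ 2 ∧ 0 ≤ z.im ∧
      0 ≤ z.re * Real.sin φ - z.im * Real.cos φ} with hS
  have hSm : MeasurableSet S := by
    have h1 : Continuous fun z : ℂ => z.re ^ 2 + z.im ^ 2 := by fun_prop
    have h2 : Continuous fun z : ℂ => z.re * Real.sin φ - z.im * Real.cos φ := by fun_prop
    exact ((isClosed_le h1 continuous_const).inter ((isClosed_le continuous_const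
      Complex.continuous_im).inter (isClosed_le continuous_const h2))).measurableSet
  have hrect : MeasurableSet (Set.Ioc 0 r ×ˢ Set.Icc 0 φ) := measurableSet_Ioc.prod measurableSet_Icc
  rw [← integral_indicator_one hSm, ← Complex.integral_comp_polarCoord_symm]
  have hcongr : ∀ p ∈ polarCoord.target,
      p.1 • S.indicator (1 : ℂ → ℝ) (Complex.polarCoord.symm p) =
        (Set.Ioc 0 r ×ˢ Set.Icc 0 φ).indicator (fun p : ℝ × ℝ => p.1 * 1) p := by
    rintro ⟨s, θ⟩ ⟨hs, hθ⟩
    have hs : 0 < s := hs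
    have hθ : -π < θ ∧ θ < π := hθ
    have hmem : Complex.polarCoord.symm (s, θ) ∈ S ↔ (s, θ) ∈ Set.Ioc 0 r ×ˢ Set.Icc 0 φ := by
      have hre : (Complex.polarCoord.symm (s, θ)).re = s * Real.cos θ := by
        simp [-ofReal_cos]
      have him : (Complex.polarCoord.symm (s, θ)).im = s * Real.sin θ := by
        simp [-ofReal_sin]
      have hnorm : (s * Real.cos θ) ^ 2 + (s * Real.sin θ) ^ 2 = s ^ 2 := by
        linear_combination s ^ 2 * Real.sin_sq_add_cos_sq θ
      have hsub : s * Real.cos θ * Real.sin φ - s * Real.sin θ * Real.cos φ =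
          s * Real.sin (φ - θ) := by rw [Real.sin_sub]; ring
      simp only [hS, Set.mem_ofPred_eq, hre, him, hnorm, hsub, Set.mem_prod, Set.mem_Ioc,
        Set.mem_Icc, mul_nonneg_iff_of_pos_left hs, sq_le_sq₀ hs.le hr, hs, true_and]
      refine and_congr_right fun _ => ⟨fun ⟨h1, h2⟩ => ?_, fun ⟨h1, h2⟩ => ?_⟩
      · have hθ0 : 0 ≤ θ := by
          by_contra! h
          exact absurd (Real.sin_neg_of_neg_of_neg_pi_lt h hθ.1) (not_lt.2 h1)
        refine ⟨hθ0, ?_⟩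
        by_contra! h
        exact absurd (Real.sin_neg_of_neg_of_neg_pi_lt (sub_neg.2 h) (by linarith)) (not_lt.2 h2)
      · exact ⟨Real.sin_nonneg_of_nonneg_of_le_pi h1 hθ.2.le,
          Real.sin_nonneg_of_nonneg_of_le_pi (by linarith) (by linarith)⟩
    by_cases h : (s, θ) ∈ Set.Ioc 0 r ×ˢ Set.Icc 0 φ
    · rw [Set.indicator_of_mem (hmem.2 h), Set.indicator_of_mem h]; simp
    · rw [Set.indicator_of_notMem (fun h' => h (hmem.1 h')), Set.indicator_of_notMem h]; simp
  have hsub : Set.Ioc 0 r ×ˢ Set.Icc 0 φ ⊆ polarCoord.target := by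
    rintro ⟨s, θ⟩ ⟨h1, h2⟩
    exact ⟨h1.1, (neg_lt_zero.2 Real.pi_pos).trans_le h2.1, h2.2.trans_lt hπ⟩
  rw [setIntegral_congr_fun polarCoord.open_target.measurableSet hcongr,
    setIntegral_indicator hrect, Set.inter_eq_self_of_subset_right hsub, Measure.volume_eq_prod,
    setIntegral_prod_mul (fun x : ℝ => x) (fun _ : ℝ => (1 : ℝ)),
    ← intervalIntegral.integral_of_le hr]
  simp only [integral_id, setIntegral_const, Real.volume_real_Icc_of_le h0.le, smul_eq_mul]
  ring

/-- The area of a circular sector. -/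
lemma volume_real_sector {A B C : ℂ} {r φ : ℝ} (hABC : 0 < side A B C) (hr : 0 ≤ r) (h0 : 0 < φ)
    (hπ : φ < π) (hcos : Real.cos φ * (‖B - A‖ * ‖C - A‖) =
      (B.re - A.re) * (C.re - A.re) + (B.im - A.im) * (C.im - A.im)) :
    volume.real (sector A B C r) = 1 / 2 * r ^ 2 * φ := by
  have hbsq : ‖B - A‖ ^ 2 = (B.re - A.re) ^ 2 + (B.im - A.im) ^ 2 := by
    rw [Complex.sq_norm, normSq_apply]; simp; ring
  have hcsq : ‖C - A‖ ^ 2 = (C.re - A.re) ^ 2 + (C.im - A.im) ^ 2 := by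
    rw [Complex.sq_norm, normSq_apply]; simp; ring
  have hb : 0 < ‖B - A‖ := by
    refine norm_pos_iff.2 fun h => hABC.ne' ?_
    rw [sub_eq_zero.1 h]; simp [side]
  have hc : 0 < ‖C - A‖ := by
    refine norm_pos_iff.2 fun h => hABC.ne' ?_
    rw [sub_eq_zero.1 h]; simp [side]
  set b := ‖B - A‖
  set c := ‖C - A‖
  have hsin : Real.sin φ * (b * c) = side A B C := by
    have hpos : 0 < Real.sin φ * (b * c) := mul_pos (Real.sin_pos_of_pos_of_lt_pi h0 hπ)
      (mul_pos hb hc)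
    refine (sq_eq_sq₀ hpos.le hABC.le).1 ?_
    have h1 := Real.sin_sq_add_cos_sq φ
    have h2 : (Real.cos φ * (b * c)) ^ 2 = _ := congrArg (· ^ 2) hcos
    have h3 : (b * c) ^ 2 = _ := (mul_pow b c 2).trans (congrArg₂ (· * ·) hbsq hcsq)
    simp only [side] at h2 h3 ⊢
    linear_combination (b * c) ^ 2 * h1 - h2 + h3
  set u : ℂ := (B - A) / b with hu_def
  have hu : ‖u‖ = 1 := by
    rw [hu_def, norm_div, norm_real, norm_of_nonneg hb.le]; exact div_self hb.ne'
  have hure : u.re = (B.re - A.re) / b := by simp [hu_def, div_ofReal_re]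
  have huim : u.im = (B.im - A.im) / b := by simp [hu_def, div_ofReal_im]
  have husq : u.re ^ 2 + u.im ^ 2 = 1 := by
    rw [hure, huim, div_pow, div_pow, ← add_div, ← hbsq, div_self (pow_pos hb 2).ne']
  rw [← volume_real_sector_aux hr h0 hπ,
    ← volume_real_preimage_add_mul A u hu (measurableSet_sector A B C r)]
  congr 1
  ext z
  have h1 : power A r (A + u * z) = z.re ^ 2 + z.im ^ 2 - r ^ 2 := by
    simp only [power, add_re, add_im, mul_re, mul_im]
    linear_combination (z.re ^ 2 + z.im ^ 2) * husq
  have h2 : side A B (A + u * z) = b * z.im := by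
    have e1 : B.re - A.re = b * u.re := by rw [hure]; field_simp
    have e2 : B.im - A.im = b * u.im := by rw [huim]; field_simp
    simp only [side, add_re, add_im, mul_re, mul_im, e1, e2]
    linear_combination b * z.im * husq
  have h3 : side C A (A + u * z) = c * (z.re * Real.sin φ - z.im * Real.cos φ) := by
    refine mul_left_cancel₀ hb.ne' ?_
    have e1 : b * u.re = B.re - A.re := by rw [hure]; field_simp
    have e2 : b * u.im = B.im - A.im := by rw [huim]; field_simp
    simp only [side, add_re, add_im, mul_re, mul_im] at hsin ⊢
    linear_combination z.im * hcos - z.re * hsin +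
      ((C.im - A.im) * z.re - (C.re - A.re) * z.im) * e1 -
      ((C.im - A.im) * z.im + (C.re - A.re) * z.re) * e2
  simp only [sector, Set.mem_preimage, Set.mem_ofPred_eq, h1, h2, h3,
    mul_nonneg_iff_of_pos_left hb, mul_nonneg_iff_of_pos_left hc, sub_nonpos]

lemma not_forall_nonneg_iff_pos {a b c f g h : ℝ} (hpos : 0 < a + b + c)
    (hneg : a * f + b * g + c * h ≤ 0) :
    ¬ ((0 ≤ a ↔ ¬ f ≤ 0) ∧ (0 ≤ b ↔ ¬ g ≤ 0) ∧ (0 ≤ c ↔ ¬ h ≤ 0)) := by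
  have key {x y : ℝ} (hxy : 0 ≤ x ↔ ¬ y ≤ 0) : 0 ≤ x * y ∧ (0 < x → 0 < x * y) := by
    rcases le_or_gt 0 x with hx | hx
    · have hy := not_le.1 (hxy.1 hx)
      exact ⟨mul_nonneg hx hy.le, fun hx' => mul_pos hx' hy⟩
    · have hy := not_not.1 (mt hxy.2 hx.not_ge)
      exact ⟨mul_nonneg_of_nonpos_of_nonpos hx.le hy, fun hx' => absurd hx' hx.not_gt⟩
  rintro ⟨hf, hg, hh⟩
  obtain ⟨f0, f1⟩ := key hf
  obtain ⟨g0, g1⟩ := key hg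
  obtain ⟨h0, h1⟩ := key hh
  have ha : a ≤ 0 := not_lt.1 fun h => by linarith [f1 h]
  have hb : b ≤ 0 := not_lt.1 fun h => by linarith [g1 h]
  have hc : c ≤ 0 := not_lt.1 fun h => by linarith [h1 h]
  linarith

/-- The inclusion–exclusion relation between a triangle and three discs centered at its vertices
whose radical center lies in all of them. -/
lemma volume_real_discInter {A B C : ℂ} {p q r : ℝ} (hABC : 0 < side A B C)
    (hneg : ∀ z, side B C z * power A p z + side C A z * power B q z +
      side A B z * power C r z ≤ 0) :
    volume.real (discInter A B C p q r) + (volume.real (sector A B C p) +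
      volume.real (sector B C A q) + volume.real (sector C A B r)) =
    volume.real (tri A B C) + (volume.real (halfLens A B p q) +
      volume.real (halfLens B C q r) + volume.real (halfLens C A r p)) := by
  have hpos (z : ℂ) : 0 < side B C z + side C A z + side A B z :=
    hABC.trans_eq (by simp only [side]; ring)
  have hsign (z : ℂ) := not_forall_nonneg_iff_pos (hpos z) (hneg z)
  have hind (z : ℂ) : (discInter A B C p q r).indicator (1 : ℂ → ℝ) z +
      ((sector A B C p).indicator 1 z + (sector B C A q).indicator 1 z +
        (sector C A B r).indicator 1 z) =
      (tri A B C).indicator 1 z + ((halfLens A B p q).indicator 1 z +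
        (halfLens B C q r).indicator 1 z + (halfLens C A r p).indicator 1 z) := by
    have hneg' : ¬ (¬ 0 ≤ side B C z ∧ ¬ 0 ≤ side C A z ∧ ¬ 0 ≤ side A B z) := fun h => by
      linarith [hpos z, not_le.1 h.1, not_le.1 h.2.1, not_le.1 h.2.2]
    have hs := hsign z
    simp only [Set.indicator_apply, discInter, sector, tri, halfLens, Set.mem_ofPred_eq,
      Pi.one_apply]
    by_cases ha : 0 ≤ side B C z <;> by_cases hb : 0 ≤ side C A z <;>
      by_cases hc : 0 ≤ side A B z <;> by_cases hf : power A p z ≤ 0 <;>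
      by_cases hg : power B q z ≤ 0 <;> by_cases hh : power C r z ≤ 0 <;>
      simp only [ha, hb, hc, hf, hg, hh, not_true_eq_false, not_false_eq_true, and_true, and_false,
        if_true, if_false, iff_true, iff_false] at hs hneg' ⊢ <;> norm_num
  have htri : volume (tri A B C) ≠ ⊤ := by
    refine ne_top_of_le_ne_top ?_ (measure_mono (t := {z | power A p z ≤ 0} ∪
      ({z | power B q z ≤ 0} ∪ {z | power C r z ≤ 0})) ?_)
    · exact measure_union_ne_top (volume_ne_top_of_subset_power subset_rfl)
        (measure_union_ne_top (volume_ne_top_of_subset_power subset_rfl)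
          (volume_ne_top_of_subset_power subset_rfl))
    · rintro z ⟨h1, h2, h3⟩
      by_contra hz
      simp only [Set.mem_union, Set.mem_ofPred_eq, not_or] at hz
      exact hsign z ⟨by simp [h1, hz.1], by simp [h2, hz.2.1], by simp [h3, hz.2.2]⟩
  have hindint {s : Set ℂ} (hs : MeasurableSet s) (hfin : volume s ≠ ⊤) :
      Integrable (s.indicator (1 : ℂ → ℝ)) :=
    (integrable_indicator_iff hs).2 (integrableOn_const hfin)
  have iD := hindint (measurableSet_discInter A B C p q r)
    (volume_ne_top_of_subset_power (A := A) (r := p) fun z hz => hz.1)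
  have iSA := hindint (measurableSet_sector A B C p)
    (volume_ne_top_of_subset_power (A := A) (r := p) fun z hz => hz.1)
  have iSB := hindint (measurableSet_sector B C A q)
    (volume_ne_top_of_subset_power (A := B) (r := q) fun z hz => hz.1)
  have iSC := hindint (measurableSet_sector C A B r)
    (volume_ne_top_of_subset_power (A := C) (r := r) fun z hz => hz.1)
  have iT := hindint (measurableSet_tri A B C) htri
  have iHC := hindint (measurableSet_halfLens A B p q)
    (volume_ne_top_of_subset_power (A := A) (r := p) fun z hz => hz.1)
  have iHA := hindint (measurableSet_halfLens B C q r)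
    (volume_ne_top_of_subset_power (A := B) (r := q) fun z hz => hz.1)
  have iHB := hindint (measurableSet_halfLens C A r p)
    (volume_ne_top_of_subset_power (A := C) (r := r) fun z hz => hz.1)
  have h := integral_congr_ae (μ := volume) (Filter.Eventually.of_forall hind)
  have hadd {f g h : ℂ → ℝ} (hf : Integrable f) (hg : Integrable g) (hh : Integrable h) :
      Integrable (fun z => f z + g z + h z) ∧
        ∫ z, f z + g z + h z = (∫ z, f z) + (∫ z, g z) + ∫ z, h z :=
    ⟨(hf.add hg).add hh, by rw [← integral_add hf hg]; exact integral_add (hf.add hg) hh⟩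
  rw [integral_add iD (hadd iSA iSB iSC).1, (hadd iSA iSB iSC).2,
    integral_add iT (hadd iHC iHA iHB).1, (hadd iHC iHA iHB).2] at h
  simpa only [integral_indicator_one, measurableSet_tri, measurableSet_sector,
    measurableSet_halfLens, measurableSet_discInter] using h

/-- The area of the triangle with vertices `0`, `ρ` and `c + h * I`. -/
lemma volume_real_tri_aux {ρ c h : ℝ} (hρ : 0 < ρ) (hh : 0 < h) :
    volume.real (tri 0 ρ ⟨c, h⟩) = 1 / 2 * ρ * h := by
  have hmeas := measurableSet_tri 0 ρ ⟨c, h⟩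
  have hm : MeasurableSet (measurableEquivRealProd.symm ⁻¹' tri 0 ρ ⟨c, h⟩) :=
    measurableEquivRealProd.symm.measurable hmeas
  rw [measureReal_def, ← (volume_preserving_equiv_real_prod.symm).measure_preimage
    hmeas.nullMeasurableSet, Measure.volume_eq_prod, Measure.prod_apply_symm hm]
  have hslice (y : ℝ) : volume ((fun x => (x, y)) ⁻¹'
      (measurableEquivRealProd.symm ⁻¹' tri 0 ρ ⟨c, h⟩)) =
      (Set.Icc 0 h).indicator (fun y => ENNReal.ofReal (ρ - ρ / h * y)) y := by
    have hset : (fun x => (x, y)) ⁻¹' (measurableEquivRealProd.symm ⁻¹' tri 0 ρ ⟨c, h⟩) =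
        {x : ℝ | 0 ≤ y ∧ x ∈ Set.Icc (c / h * y) (ρ + (c - ρ) / h * y)} := by
      ext x
      have h1 : side ρ ⟨c, h⟩ ⟨x, y⟩ = h * (ρ + (c - ρ) / h * y - x) := by
        simp only [side, ofReal_re, ofReal_im]; field_simp; ring
      have h2 : side ⟨c, h⟩ 0 ⟨x, y⟩ = h * (x - c / h * y) := by
        simp only [side, zero_re, zero_im]; field_simp; ring
      have h3 : side 0 ρ ⟨x, y⟩ = ρ * y := by simp [side]
      simp only [tri, Set.mem_preimage, Set.mem_ofPred_eq, measurableEquivRealProd_symm_apply,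
        h1, h2, h3, mul_nonneg_iff_of_pos_left hh, mul_nonneg_iff_of_pos_left hρ, sub_nonneg,
        Set.mem_Icc]
      tauto
    have hlen : ρ + (c - ρ) / h * y - c / h * y = ρ - ρ / h * y := by field_simp; ring
    rw [hset]
    by_cases hy : 0 ≤ y
    · simp only [hy, true_and, Set.ofPred_mem_eq, Real.volume_Icc, hlen]
      by_cases hy' : y ≤ h
      · rw [Set.indicator_of_mem (Set.mem_Icc.2 ⟨hy, hy'⟩)]
      · rw [Set.indicator_of_notMem fun h => hy' h.2, ENNReal.ofReal_of_nonpos]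
        rw [sub_nonpos, div_mul_eq_mul_div, le_div_iff₀ hh]
        exact mul_le_mul_of_nonneg_left (not_le.1 hy').le hρ.le
    · simp [hy]
  simp_rw [hslice]
  rw [lintegral_indicator measurableSet_Icc, ← ofReal_integral_eq_lintegral_ofReal]
  · have hval : ∫ y in Set.Icc 0 h, (ρ - ρ / h * y) = 1 / 2 * ρ * h := by
      rw [integral_Icc_eq_integral_Ioc, ← intervalIntegral.integral_of_le hh.le,
        intervalIntegral.integral_sub (by simp)
          (Continuous.intervalIntegrable (by fun_prop) _ _), intervalIntegral.integral_const_mul,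
        intervalIntegral.integral_const, integral_id, smul_eq_mul]
      field_simp
      ring
    rw [hval, ENNReal.toReal_ofReal (by positivity)]
  · exact (Continuous.continuousOn (by fun_prop)).integrableOn_Icc
  · refine (ae_restrict_mem measurableSet_Icc).mono fun y hy => ?_
    simp only [Pi.zero_apply, sub_nonneg]
    rw [div_mul_eq_mul_div, div_le_iff₀ hh]
    exact mul_le_mul_of_nonneg_left hy.2 hρ.le

/-- The area of a half-lens in terms of the central angles of its arcs. -/
lemma volume_real_halfLens {A B : ℂ} {p q α β : ℝ} (hAB : A ≠ B) (hp : 0 < p) (hq : 0 < q)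
    (hα0 : 0 < α / 2) (hαπ : α / 2 < π)
    (hα : Real.cos (α / 2) = (p ^ 2 + ‖B - A‖ ^ 2 - q ^ 2) / (2 * ‖B - A‖ * p))
    (hβ0 : 0 < β / 2) (hβπ : β / 2 < π)
    (hβ : Real.cos (β / 2) = (q ^ 2 + ‖B - A‖ ^ 2 - p ^ 2) / (2 * ‖B - A‖ * q)) :
    volume.real (halfLens A B p q) =
      1 / 4 * p ^ 2 * (α - Real.sin α) + 1 / 4 * q ^ 2 * (β - Real.sin β) := by
  have hρ : 0 < ‖B - A‖ := norm_pos_iff.2 (sub_ne_zero.2 hAB.symm)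
  set ρ := ‖B - A‖ with hρ_def
  set u : ℂ := (B - A) / ρ with hu_def
  have hu : ‖u‖ = 1 := by
    rw [hu_def, norm_div, norm_real, norm_of_nonneg hρ.le]; exact div_self hρ.ne'
  have husq : u.re ^ 2 + u.im ^ 2 = 1 := by
    rw [← Complex.normSq_add_mul_I, re_add_im, Complex.normSq_eq_norm_sq, hu, one_pow]
  have hB : B = A + u * ρ := by
    rw [hu_def, div_mul_cancel₀ _ (ofReal_ne_zero.2 hρ.ne')]; ring
  have hnorm : volume.real (halfLens A B p q) = volume.real (halfLens 0 ρ p q) := by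
    rw [← volume_real_preimage_add_mul A u hu (measurableSet_halfLens A B p q)]
    congr 1
    ext z
    have h1 : power A p (A + u * z) = power 0 p z := by
      simp only [power, add_re, add_im, mul_re, mul_im, zero_re, zero_im]
      linear_combination (z.re ^ 2 + z.im ^ 2) * husq
    have h2 : power B q (A + u * z) = power ρ q z := by
      simp only [power, hB, add_re, add_im, mul_re, mul_im, ofReal_re, ofReal_im]
      linear_combination ((z.re - ρ) ^ 2 + z.im ^ 2) * husq
    have h3 : side A B (A + u * z) = side 0 ρ z := by
      simp only [side, hB, add_re, add_im, mul_re, mul_im, ofReal_re, ofReal_im, zero_re, zero_im]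
      linear_combination ρ * z.im * husq
    simp only [halfLens, Set.mem_preimage, Set.mem_ofPred_eq, h1, h2, h3]
  have hsα := Real.sin_pos_of_pos_of_lt_pi hα0 hαπ
  have hsβ := Real.sin_pos_of_pos_of_lt_pi hβ0 hβπ
  have hα' : 2 * ρ * (p * Real.cos (α / 2)) = p ^ 2 + ρ ^ 2 - q ^ 2 := by
    rw [hα]; field_simp
  have hβ' : 2 * ρ * (q * Real.cos (β / 2)) = q ^ 2 + ρ ^ 2 - p ^ 2 := by
    rw [hβ]; field_simp
  have hbase : p * Real.cos (α / 2) + q * Real.cos (β / 2) = ρ :=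
    mul_left_cancel₀ (mul_pos two_pos hρ).ne' (by linear_combination hα' + hβ')
  have htα := Real.sin_sq_add_cos_sq (α / 2)
  have htβ := Real.sin_sq_add_cos_sq (β / 2)
  have hheight : p * Real.sin (α / 2) = q * Real.sin (β / 2) := by
    refine (sq_eq_sq₀ (mul_pos hp hsα).le (mul_pos hq hsβ).le).1 ?_
    have e : q * Real.cos (β / 2) = ρ - p * Real.cos (α / 2) := by linarith
    have e2 : (q * Real.cos (β / 2)) ^ 2 = _ := congrArg (· ^ 2) e
    linear_combination p ^ 2 * htα - q ^ 2 * htβ + e2 - hα'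
  set x := p * Real.cos (α / 2) with hx
  set y := p * Real.sin (α / 2) with hy
  have hy0 : 0 < y := mul_pos hp hsα
  set Q : ℂ := ⟨x, y⟩ with hQ
  have hxyp : x ^ 2 + y ^ 2 = p ^ 2 := by rw [hx, hy]; linear_combination p ^ 2 * htα
  have hxyq : (x - ρ) ^ 2 + y ^ 2 = q ^ 2 := by linear_combination hxyp - hα'
  have hside : 0 < side 0 ρ Q := by simpa [side, hQ] using mul_pos hρ hy0
  have hmain := volume_real_discInter (p := p) (q := q) (r := 0) hside fun z => by
    have e : side ρ Q z * power 0 p z + side Q 0 z * power ρ q z + side 0 ρ z * power Q 0 z =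
        - (ρ * y) * ((z.re - x) ^ 2 + (z.im - y) ^ 2) := by
      simp only [side, power, hQ, zero_re, zero_im, ofReal_re, ofReal_im]
      rw [← hxyp, ← hxyq]
      ring
    rw [e]
    have := mul_pos hρ hy0
    nlinarith [sq_nonneg (z.re - x), sq_nonneg (z.im - y)]
  have hnp : ‖Q - 0‖ = p := by
    rw [sub_zero, Complex.norm_eq_sqrt_sq_add_sq, hxyp, Real.sqrt_sq hp.le]
  have hnq : ‖Q - ρ‖ = q := by
    rw [Complex.norm_eq_sqrt_sq_add_sq]
    simp [hQ, hxyq, hq.le]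
  have hnρ : ‖(ρ : ℂ) - 0‖ = ρ := by simp [hρ.le]
  have hS1 : volume.real (sector 0 ρ Q p) = 1 / 2 * p ^ 2 * (α / 2) :=
    volume_real_sector hside hp.le hα0 hαπ (by
      rw [hnp, hnρ]; simp [hQ, hx]; ring)
  have hS2 : volume.real (sector ρ Q 0 q) = 1 / 2 * q ^ 2 * (β / 2) :=
    volume_real_sector (hside.trans_eq (by simp only [side]; ring)) hq.le hβ0 hβπ (by
      rw [hnq, norm_sub_rev, hnρ]; simp [hQ]; linear_combination ρ * hbase)
  have hS3 : volume.real (sector Q 0 ρ 0) = 0 :=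
    volume_real_eq_zero_of_subset_power (A := Q) fun z hz => hz.1
  have hD0 : volume.real (discInter 0 ρ Q p q 0) = 0 :=
    volume_real_eq_zero_of_subset_power (A := Q) fun z hz => hz.2.2
  have hL1 : volume.real (halfLens ρ Q q 0) = 0 :=
    volume_real_eq_zero_of_subset_power (A := Q) fun z hz => hz.2.1
  have hL2 : volume.real (halfLens Q 0 0 p) = 0 :=
    volume_real_eq_zero_of_subset_power (A := Q) fun z hz => hz.1
  rw [hS1, hS2, hS3, hD0, hL1, hL2, volume_real_tri_aux hρ hy0] at hmain
  have dα : Real.sin α = 2 * Real.sin (α / 2) * Real.cos (α / 2) := by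
    rw [← Real.sin_two_mul]; ring_nf
  have dβ : Real.sin β = 2 * Real.sin (β / 2) * Real.cos (β / 2) := by
    rw [← Real.sin_two_mul]; ring_nf
  rw [hnorm, dα, dβ]
  linear_combination -hmain + 1 / 2 * y * hbase - 1 / 2 * q * Real.cos (β / 2) * hheight

end PlaneGeometry

lemma seq0s_univ : seq0s (univ : Finset (Fin 3)) =
    (![Lbl.zero, Lbl.star, Lbl.idx 0, Lbl.idx 1, Lbl.idx 2] : Fin 5 → Lbl 3) := by
  have h : (fun i : Fin 3 => i) = (univ : Finset (Fin 3)).orderEmbOfFin rfl :=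
    orderEmbOfFin_unique _ (fun _ => mem_univ _) strictMono_id
  have h' (i : Fin 3) : (univ : Finset (Fin 3)).orderEmbOfFin rfl i = i := (congrFun h i).symm
  funext i
  change Fin 5 at i
  fin_cases i
  · rfl
  · rfl
  · exact congrArg Lbl.idx (h' 0)
  · exact congrArg Lbl.idx (h' 1)
  · exact congrArg Lbl.idx (h' 2)

/-- `B(0⋆123)` as an explicit determinant. -/
lemma B0s_univ (rad : Fin 3 → ℝ) (ρ : Fin 3 → Fin 3 → ℝ) :
    B0s rad ρ univ = Matrix.det !![0, 1, 1, 1, 1;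
      1, 0, rad 0 ^ 2, rad 1 ^ 2, rad 2 ^ 2;
      1, rad 0 ^ 2, ρ 0 0 ^ 2, ρ 0 1 ^ 2, ρ 0 2 ^ 2;
      1, rad 1 ^ 2, ρ 1 0 ^ 2, ρ 1 1 ^ 2, ρ 1 2 ^ 2;
      1, rad 2 ^ 2, ρ 2 0 ^ 2, ρ 2 1 ^ 2, ρ 2 2 ^ 2] := by
  rw [B0s, seq0s_univ]
  change Matrix.det _ = _
  congr 1
  ext i j
  fin_cases i <;> fin_cases j <;> rfl

/-- `B(0⋆123)` in terms of the radical center `(x, y)`. -/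
lemma det_radicalCenter (α β γ R x y : ℝ) :
    Matrix.det !![0, 1, 1, 1, 1;
      1, 0, R + β ^ 2 + γ ^ 2 + 2 * β * x + 2 * γ * y, R + α ^ 2 + 2 * α * x, R;
      1, R + β ^ 2 + γ ^ 2 + 2 * β * x + 2 * γ * y, 0, (β - α) ^ 2 + γ ^ 2, β ^ 2 + γ ^ 2;
      1, R + α ^ 2 + 2 * α * x, (β - α) ^ 2 + γ ^ 2, 0, α ^ 2;
      1, R, β ^ 2 + γ ^ 2, α ^ 2, 0] = 8 * (α * γ) ^ 2 * (R - x ^ 2 - y ^ 2) := by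
  simp [Matrix.det_succ_row_zero, Fin.sum_univ_succ, Fin.succAbove]
  ring

lemma convex_side_nonneg (A B : ℂ) : Convex ℝ {z | 0 ≤ side A B z} := by
  intro x hx y hy s t hs ht hst
  have hx' : 0 ≤ side A B x := hx
  have hy' : 0 ≤ side A B y := hy
  have h : side A B (s • x + t • y) = s * side A B x + t * side A B y := by
    simp only [side, Complex.add_re, Complex.add_im, Complex.real_smul, Complex.re_ofReal_mul,
      Complex.im_ofReal_mul]
    linear_combination (A.re * (B.im - A.im) - A.im * (B.re - A.re)) * -hst
  rw [Set.mem_ofPred_eq, h]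
  positivity

lemma tri_eq_convexHull {A B C : ℂ} (hABC : 0 < side A B C) :
    tri A B C = convexHull ℝ {A, B, C} := by
  have hBCA : side B C A = side A B C := by simp only [side]; ring
  have hCAB : side C A B = side A B C := by simp only [side]; ring
  have hleft (x y : ℂ) : side x y x = 0 := by simp [side]
  have hright (x y : ℂ) : side x y y = 0 := by simp only [side]; ring
  refine Set.Subset.antisymm (fun z hz => ?_) (convexHull_min ?_ ?_)
  · obtain ⟨h1, h2, h3⟩ := hz
    have hz : z = ∑ i, (![side B C z / side A B C, side C A z / side A B C,
        side A B z / side A B C] i) • (![A, B, C] i) := by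
      have hne := hABC.ne'
      apply Complex.ext <;> simp [Fin.sum_univ_three] <;> field_simp <;> simp only [side] <;> ring
    rw [hz]
    refine (convex_convexHull ℝ _).sum_mem (fun i _ => ?_) ?_ (fun i _ => subset_convexHull ℝ _ ?_)
    · fin_cases i <;> simp <;> positivity
    · simp only [Fin.sum_univ_three, Matrix.cons_val]
      rw [← add_div, ← add_div, div_eq_one_iff_eq hABC.ne']
      simp only [side]; ring
    · fin_cases i <;> simp
  · rintro z (rfl | rfl | rfl) <;> simp [tri, hleft, hright, hBCA, hCAB, hABC.le]
  · exact (convex_side_nonneg B C).inter ((convex_side_nonneg C A).inter (convex_side_nonneg A B))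

/-- The center `-a` of a circle as a complex number. -/
def centerC (a : EuclideanSpace ℝ (Fin 2)) : ℂ := ⟨-a 0, -a 1⟩

lemma repr_centerC (a : EuclideanSpace ℝ (Fin 2)) :
    Complex.orthonormalBasisOneI.repr (centerC a) = -a := by
  ext i
  fin_cases i <;> simp [centerC]

lemma norm_centerC_sub (a b : EuclideanSpace ℝ (Fin 2)) :
    ‖centerC a - centerC b‖ = dist a b := by
  rw [← Complex.orthonormalBasisOneI.repr.norm_map, map_sub, repr_centerC, repr_centerC,
    ← dist_eq_norm, dist_neg_neg]

lemma fQ_repr (a : Fin (2 + 1) → EuclideanSpace ℝ (Fin 2)) (α0 : Fin (2 + 1) → ℝ)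
    (hrad : ∀ j, 0 < ‖a j‖ ^ 2 - α0 j) (j : Fin (2 + 1)) (z : ℂ) :
    fQ a α0 j (Complex.orthonormalBasisOneI.repr z) = power (centerC (a j)) (radius a α0 j) z := by
  rw [power, radius, Real.sq_sqrt (hrad j).le]
  simp only [fQ, centerC, EuclideanSpace.norm_sq_eq,
    PiLp.inner_apply, Fin.sum_univ_two]
  simp
  ring

lemma volume_real_preimage_repr (s : Set (EuclideanSpace ℝ (Fin 2))) :
    volume.real (Complex.orthonormalBasisOneI.repr ⁻¹' s) = volume.real s := by
  exact congrArg ENNReal.toReal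
    (Complex.orthonormalBasisOneI.measurePreserving_measurableEquiv.measure_preimage_equiv s)

/-- **Lemma 12** (`n = 2`): the area of the pseudo-triangle with circular-arc sides:
`area(D) = area(ΔO₁O₂O₃) - Σ_j ½ r_j² φ_j + Σ_{j<k} (¼ r_j²(ψ_{jk} - sin ψ_{jk})
+ ¼ r_k²(ψ_{kj} - sin ψ_{kj}))`. -/
theorem area_pseudo_triangle
    (a : Fin (2 + 1) → EuclideanSpace ℝ (Fin 2)) (α0 : Fin (2 + 1) → ℝ)
    (hrad : ∀ j, 0 < ‖a j‖ ^ 2 - α0 j)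
    (hH1 : H1 (radius a α0) (cdist a))
    (htri : Triangular a) (hdiag : DiagPos a)
    (hD : (interior (Dm a α0)).Nonempty)
    (P : Fin (2 + 1) → EuclideanSpace ℝ (Fin 2))
    (hPsph : ∀ j, ∀ k, k ≠ j → fQ a α0 k (P j) = 0)
    (hPbd : ∀ j, P j ∈ frontier (Dm a α0))
    (hPuniq : ∀ j x, (∀ k, k ≠ j → fQ a α0 k x = 0) → x ∈ frontier (Dm a α0) → x = P j)
    (hH2 : H2 P)
    (φ : Fin (2 + 1) → ℝ) (ψ : Fin (2 + 1) → Fin (2 + 1) → ℝ)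
    (hφ : ∀ j k l : Fin (2 + 1), j ≠ k → j ≠ l → k ≠ l →
      0 < φ j ∧ φ j < Real.pi ∧
      Real.cos (φ j) =
        (cdist a j k ^ 2 + cdist a j l ^ 2 - cdist a k l ^ 2) /
          (2 * cdist a j k * cdist a j l))
    (hψ : ∀ j k : Fin (2 + 1), j ≠ k →
      0 < ψ j k / 2 ∧ ψ j k / 2 < Real.pi ∧
      Real.cos (ψ j k / 2) =
        (radius a α0 j ^ 2 + cdist a j k ^ 2 - radius a α0 k ^ 2) /
          (2 * cdist a j k * radius a α0 j)) :
    (volume (Dm a α0)).toReal =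
      (volume (convexHull ℝ
          ({-(a 0), -(a 1), -(a 2)} : Set (EuclideanSpace ℝ (Fin 2))))).toReal
        - ∑ j : Fin (2 + 1), (1 / 2 : ℝ) * radius a α0 j ^ 2 * φ j
        + ∑ j : Fin (2 + 1), ∑ k : Fin (2 + 1),
            (if j < k then
              (1 / 4 : ℝ) * radius a α0 j ^ 2 * (ψ j k - Real.sin (ψ j k))
                + (1 / 4 : ℝ) * radius a α0 k ^ 2 * (ψ k j - Real.sin (ψ k j))
            else 0) := by
  have hα : 0 < a 1 0 := hdiag 1 0 (by decide) (by decide)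
  have hγ : 0 < a 0 1 := hdiag 0 1 (by decide) (by decide)
  have ha11 : a 1 1 = 0 := htri 1 1 (by decide)
  have ha20 : a 2 0 = 0 := htri 2 0 (by decide)
  have ha21 : a 2 1 = 0 := htri 2 1 (by decide)
  have hr (j) : 0 < radius a α0 j := Real.sqrt_pos.2 (hrad j)
  set A := centerC (a 2) with hA
  set B := centerC (a 1) with hB
  set C := centerC (a 0) with hC
  have hABC : 0 < side A B C := by
    simpa [side, hA, hB, hC, centerC, ha11, ha20, ha21] using mul_pos hα hγ
  have hsq (j k : Fin (2 + 1)) : cdist a j k ^ 2 = (a j 0 - a k 0) ^ 2 + (a j 1 - a k 1) ^ 2 := by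
    rw [cdist, EuclideanSpace.dist_eq, Real.sq_sqrt (by positivity)]
    simp [Fin.sum_univ_two, Real.dist_eq]
  have hcomm (j k : Fin (2 + 1)) : cdist a j k = cdist a k j := dist_comm _ _
  have hne (j k : Fin (2 + 1)) (hjk : a j ≠ a k) : 0 < cdist a j k := dist_pos.2 hjk
  have h12 : 0 < cdist a 1 2 := hne 1 2 fun h => by rw [h, ha20] at hα; exact hα.false
  have h02 : 0 < cdist a 0 2 := hne 0 2 fun h => by rw [h, ha21] at hγ; exact hγ.false
  have h01 : 0 < cdist a 0 1 := hne 0 1 fun h => by rw [h, ha11] at hγ; exact hγ.false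
  have hneg : ∀ z, side B C z * power A (radius a α0 2) z +
      side C A z * power B (radius a α0 1) z + side A B z * power C (radius a α0 0) z ≤ 0 := by
    obtain ⟨x, hx⟩ : ∃ x, radius a α0 1 ^ 2 = radius a α0 2 ^ 2 + a 1 0 ^ 2 + 2 * a 1 0 * x :=
      ⟨(radius a α0 1 ^ 2 - radius a α0 2 ^ 2 - a 1 0 ^ 2) / (2 * a 1 0), by field_simp; ring⟩
    obtain ⟨y, hy⟩ : ∃ y, radius a α0 0 ^ 2 = radius a α0 2 ^ 2 + a 0 0 ^ 2 + a 0 1 ^ 2 +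
        2 * a 0 0 * x + 2 * a 0 1 * y :=
      ⟨(radius a α0 0 ^ 2 - radius a α0 2 ^ 2 - a 0 0 ^ 2 - a 0 1 ^ 2 - 2 * a 0 0 * x) /
        (2 * a 0 1), by field_simp; ring⟩
    have hdet := (hH1 univ univ_nonempty).2
    have h00 (j : Fin (2 + 1)) : cdist a j j ^ 2 = 0 := by rw [hsq]; ring
    have hd01 : cdist a 0 1 ^ 2 = (a 0 0 - a 1 0) ^ 2 + a 0 1 ^ 2 := by rw [hsq, ha11]; ring
    have hd02 : cdist a 0 2 ^ 2 = a 0 0 ^ 2 + a 0 1 ^ 2 := by rw [hsq, ha20, ha21]; ring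
    have hd12 : cdist a 1 2 ^ 2 = a 1 0 ^ 2 := by rw [hsq, ha11, ha20, ha21]; ring
    rw [B0s_univ, hx, hy, hcomm 1 0, hcomm 2 0, hcomm 2 1, h00, h00, h00, hd01, hd02, hd12,
      det_radicalCenter, Finset.card_univ, Fintype.card_fin,
      show (-1 : ℝ) ^ (2 + 1 + 1) = 1 by norm_num, one_mul] at hdet
    have hpow : 0 < radius a α0 2 ^ 2 - x ^ 2 - y ^ 2 :=
      pos_of_mul_pos_right hdet (by positivity)
    intro z
    have e : side B C z * power A (radius a α0 2) z + side C A z * power B (radius a α0 1) z +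
        side A B z * power C (radius a α0 0) z = -(a 1 0 * a 0 1) *
          ((z.re - x) ^ 2 + (z.im - y) ^ 2 + (radius a α0 2 ^ 2 - x ^ 2 - y ^ 2)) := by
      simp only [side, power, hx, hy, hA, hB, hC, centerC, ha11, ha20, ha21]
      ring
    rw [e, neg_mul, neg_nonpos]
    positivity
  have hmain := volume_real_discInter hABC hneg
  have hAB : ‖B - A‖ = cdist a 1 2 := norm_centerC_sub _ _
  have hBC : ‖C - B‖ = cdist a 0 1 := norm_centerC_sub _ _
  have hCA : ‖A - C‖ = cdist a 0 2 := by rw [norm_sub_rev]; exact norm_centerC_sub _ _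
  have hS2 : volume.real (sector A B C (radius a α0 2)) = 1 / 2 * radius a α0 2 ^ 2 * φ 2 := by
    obtain ⟨h1, h2, h3⟩ := hφ 2 1 0 (by decide) (by decide) (by decide)
    refine volume_real_sector hABC (hr 2).le h1 h2 ?_
    rw [h3, hAB, norm_sub_rev, hCA, hcomm 2 1, hcomm 2 0, hcomm 1 0, div_mul_eq_mul_div,
      div_eq_iff (by positivity), hsq, hsq, hsq]
    simp only [hA, hB, hC, centerC]
    ring
  have hS1 : volume.real (sector B C A (radius a α0 1)) = 1 / 2 * radius a α0 1 ^ 2 * φ 1 := by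
    obtain ⟨h1, h2, h3⟩ := hφ 1 0 2 (by decide) (by decide) (by decide)
    refine volume_real_sector (hABC.trans_eq (by simp only [side]; ring)) (hr 1).le h1 h2 ?_
    rw [h3, hBC, norm_sub_rev, hAB, hcomm 1 0, div_mul_eq_mul_div,
      div_eq_iff (by positivity), hsq, hsq, hsq]
    simp only [hA, hB, hC, centerC]
    ring
  have hS0 : volume.real (sector C A B (radius a α0 0)) = 1 / 2 * radius a α0 0 ^ 2 * φ 0 := by
    obtain ⟨h1, h2, h3⟩ := hφ 0 2 1 (by decide) (by decide) (by decide)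
    refine volume_real_sector (hABC.trans_eq (by simp only [side]; ring)) (hr 0).le h1 h2 ?_
    rw [h3, hCA, norm_sub_rev, hBC, hcomm 2 1, div_mul_eq_mul_div,
      div_eq_iff (by positivity), hsq, hsq, hsq]
    simp only [hA, hB, hC, centerC]
    ring
  have hlens (j k : Fin (2 + 1)) (hjk : j ≠ k) (hd : 0 < cdist a j k) :
      volume.real (halfLens (centerC (a k)) (centerC (a j)) (radius a α0 k) (radius a α0 j)) =
        1 / 4 * radius a α0 k ^ 2 * (ψ k j - Real.sin (ψ k j)) +
          1 / 4 * radius a α0 j ^ 2 * (ψ j k - Real.sin (ψ j k)) := by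
    obtain ⟨h1, h2, h3⟩ := hψ k j hjk.symm
    obtain ⟨g1, g2, g3⟩ := hψ j k hjk
    have hn : ‖centerC (a j) - centerC (a k)‖ = cdist a j k := norm_centerC_sub _ _
    refine volume_real_halfLens (fun h => ?_) (hr k) (hr j) h1 h2 ?_ g1 g2 ?_
    · rw [h, sub_self, norm_zero] at hn
      exact hd.ne hn
    · rw [h3, hn, hcomm k j]
    · rw [g3, hn]
  rw [hS0, hS1, hS2, hlens 1 2 (by decide) h12, hlens 0 1 (by decide) h01,
    hlens 2 0 (by decide) (hcomm 2 0 ▸ h02)] at hmain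
  have hD' : volume.real (Dm a α0) =
      volume.real (discInter A B C (radius a α0 2) (radius a α0 1) (radius a α0 0)) := by
    rw [← volume_real_preimage_repr]
    congr 1
    ext z
    simp only [Dm, discInter, Set.mem_preimage, Set.mem_ofPred_eq, fQ_repr a α0 hrad,
      Fin.forall_fin_succ (n := 2), Fin.forall_fin_two]
    exact ⟨fun h => ⟨h.2.2, h.2.1, h.1⟩, fun h => ⟨h.2.2, h.2.1, h.1⟩⟩
  have hT : volume.real (convexHull ℝ ({-(a 0), -(a 1), -(a 2)} :
      Set (EuclideanSpace ℝ (Fin 2)))) = volume.real (tri A B C) := by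
    have himage : convexHull ℝ ({-(a 0), -(a 1), -(a 2)} : Set (EuclideanSpace ℝ (Fin 2))) =
        Complex.orthonormalBasisOneI.repr '' convexHull ℝ {C, B, A} := by
      have h := Complex.orthonormalBasisOneI.repr.toLinearEquiv.toLinearMap.image_convexHull
        {C, B, A}
      simpa [Set.image_insert_eq, hA, hB, hC, repr_centerC] using h.symm
    rw [himage, ← volume_real_preimage_repr, Set.preimage_image_eq _
      Complex.orthonormalBasisOneI.repr.injective, tri_eq_convexHull hABC]
    congr 2
    ext z
    simp only [Set.mem_insert_iff, Set.mem_singleton_iff]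
    tauto
  rw [← measureReal_def, ← measureReal_def, hD', hT]
  simp only [Fin.sum_univ_succ (n := 2), Fin.sum_univ_two]
  norm_num [Fin.lt_def]
  linear_combination hmain

end SchlafliVol
end

section
/- Let n ≥ 2. Let S_{n+1} = {x ∈ ℝⁿ : |x| = 1} be the unit sphere (r_{n+1} = 1, O_{n+1} = 0) and for 1 ≤ j ≤ n let S_j be the sphere of center O_j and radius r_j; set ρ_{jk} = |O_j − O_k| (including ρ_{j,n+1} = |O_j|). Assume B(0⋆{j, n+1}) < 0 for each j (each S_j meets S_{n+1} in an (n−2)-sphere). With f_j(x) = |x|² − 2⟨O_j, x⟩ + |O_j|² − r_j², define the affine function f′_j := f_j − |x|² + 1 and let f′_j/c_j = Σ_ν u_{jν} x_ν + u_{j0} be its normalization by the unique c_j > 0 making Σ_ν u_{jν}² − u_{j0}² = 1. Then with a′_{j0} := u_{j0} and a′_{jk} := Σ_ν u_{jν} u_{kν} − u_{j0} u_{k0}: a′_{j0} = B(0 j n+1 | 0 ⋆ n+1) / √(−B(0⋆{j, n+1})) and, for 1 ≤ j, k ≤ n, a′_{jk} = − B(0 ⋆ j n+1 | 0 ⋆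 k n+1) / √( B(0⋆{j, n+1}) · B(0⋆{k, n+1}) ). -/
open MeasureTheory Metric Finset
open scoped BigOperators

namespace SchlafliVol

variable {m : ℕ}

variable {n : ℕ}

variable {n : ℕ}

/-- The radii of the arrangement `S₁, …, S_n, S_{n+1}`, the last hypersphere being
the unit hypersphere. -/
noncomputable def radExt (r : Fin n → ℝ) : Fin (n + 1) → ℝ :=
  Fin.snoc r 1

/-- The centers of the arrangement, the last one being the origin. -/
noncomputable def ctrExt (O : Fin n → EuclideanSpace ℝ (Fin n)) :
    Fin (n + 1) → EuclideanSpace ℝ (Fin n) :=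
  Fin.snoc O 0

/-- The mutual distances `ρ_{jk}` of the centers of the arrangement. -/
noncomputable def distExt (O : Fin n → EuclideanSpace ℝ (Fin n))
    (i k : Fin (n + 1)) : ℝ :=
  dist (ctrExt O i) (ctrExt O k)

/-- `B(0⋆J)` may be computed along the increasing enumeration of `J` by `Fin p`, `p = |J|`. -/
theorem B0s_eq_of_card (rad : Fin m → ℝ) (ρ : Fin m → Fin m → ℝ) (J : Finset (Fin m))
    {p : ℕ} (h : J.card = p) :
    B0s rad ρ J =
      Bdet rad ρ
        (Fin.cons Lbl.zero <| Fin.cons Lbl.star fun i => Lbl.idx (J.orderEmbOfFin h i))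
        (Fin.cons Lbl.zero <| Fin.cons Lbl.star fun i => Lbl.idx (J.orderEmbOfFin h i)) := by
  subst h
  rfl

theorem B0s_pair (rad : Fin m → ℝ) (ρ : Fin m → Fin m → ℝ) {i k : Fin m} (hik : i < k) :
    B0s rad ρ {i, k} =
      Bdet rad ρ ![Lbl.zero, Lbl.star, Lbl.idx i, Lbl.idx k]
        ![Lbl.zero, Lbl.star, Lbl.idx i, Lbl.idx k] := by
  have hcard : ({i, k} : Finset (Fin m)).card = 2 := Finset.card_pair hik.ne
  have henum : ![i, k] = ({i, k} : Finset (Fin m)).orderEmbOfFin hcard := by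
    refine Finset.orderEmbOfFin_unique hcard (fun x => ?_) ?_
    · fin_cases x <;> simp
    · intro x y hxy
      fin_cases x <;> fin_cases y <;> simp_all
  have hlabels : (Fin.cons Lbl.zero <| Fin.cons Lbl.star fun x =>
      Lbl.idx (({i, k} : Finset (Fin m)).orderEmbOfFin hcard x) : Fin 4 → Lbl m) =
      ![Lbl.zero, Lbl.star, Lbl.idx i, Lbl.idx k] := by
    rw [← henum]
    ext x
    fin_cases x <;> rfl
  rw [B0s_eq_of_card rad ρ _ hcard, hlabels]

theorem Bdet_zero_idx_last (O : Fin n → EuclideanSpace ℝ (Fin n)) (r : Fin n → ℝ) (j : Fin n) :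
    Bdet (radExt r) (distExt O)
        ![Lbl.zero, Lbl.idx j.castSucc, Lbl.idx (Fin.last n)]
        ![Lbl.zero, Lbl.star, Lbl.idx (Fin.last n)] =
      ‖O j‖ ^ 2 - r j ^ 2 + 1 := by
  simp [Bdet, Matrix.det_fin_three, ent, radExt, distExt, ctrExt]
  ring

theorem Bdet_zero_star_idx_last (O : Fin n → EuclideanSpace ℝ (Fin n)) (r : Fin n → ℝ)
    (j k : Fin n) :
    Bdet (radExt r) (distExt O)
        ![Lbl.zero, Lbl.star, Lbl.idx j.castSucc, Lbl.idx (Fin.last n)]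
        ![Lbl.zero, Lbl.star, Lbl.idx k.castSucc, Lbl.idx (Fin.last n)] =
      (‖O j‖ ^ 2 - r j ^ 2 + 1) * (‖O k‖ ^ 2 - r k ^ 2 + 1) - 4 * inner ℝ (O j) (O k) := by
  have hdist : dist (O j) (O k) ^ 2 = ‖O j‖ ^ 2 - 2 * inner ℝ (O j) (O k) + ‖O k‖ ^ 2 := by
    rw [dist_eq_norm, norm_sub_sq_real]
  simp [Bdet, Matrix.det_succ_row_zero, Fin.sum_univ_succ, Fin.succAbove, ent, radExt, distExt,
    ctrExt, hdist]
  ring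

/-- Formulas (38)–(39): the entries of the normalized hyperplane configuration matrix
`A′` obtained by restricting the hypersphere arrangement to the unit hypersphere, in
terms of Cayley–Menger determinants (the index `n+1`, i.e. `Fin.last n`, labels the
unit hypersphere). -/
theorem configuration_matrix_entries
    (n : ℕ) (hn : 2 ≤ n)
    (O : Fin n → EuclideanSpace ℝ (Fin n)) (r : Fin n → ℝ) (hr : ∀ j, 0 < r j)
    (hmeet : ∀ j : Fin n,
      B0s (radExt r) (distExt O) ({j.castSucc, Fin.last n} : Finset (Fin (n + 1))) < 0)
    (c : Fin n → ℝ) (hc : ∀ j, 0 < c j)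
    (u : Fin n → Fin n → ℝ) (u0 : Fin n → ℝ)
    (hnormal : ∀ (j : Fin n) (x : EuclideanSpace ℝ (Fin n)),
      ((‖x‖ ^ 2 - 2 * (inner ℝ (O j) x : ℝ) + ‖O j‖ ^ 2 - r j ^ 2) - ‖x‖ ^ 2 + 1) =
        c j * ((∑ ν, u j ν * x ν) + u0 j))
    (hnorm : ∀ j, (∑ ν, u j ν ^ 2) - u0 j ^ 2 = 1) :
    (∀ j : Fin n,
      u0 j =
        Bdet (radExt r) (distExt O)
            ![Lbl.zero, Lbl.idx j.castSucc, Lbl.idx (Fin.last n)]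
            ![Lbl.zero, Lbl.star, Lbl.idx (Fin.last n)] /
          Real.sqrt (- B0s (radExt r) (distExt O)
            ({j.castSucc, Fin.last n} : Finset (Fin (n + 1))))) ∧
    (∀ j k : Fin n,
      (∑ ν, u j ν * u k ν) - u0 j * u0 k =
        - Bdet (radExt r) (distExt O)
            ![Lbl.zero, Lbl.star, Lbl.idx j.castSucc, Lbl.idx (Fin.last n)]
            ![Lbl.zero, Lbl.star, Lbl.idx k.castSucc, Lbl.idx (Fin.last n)] /
          Real.sqrt
            (B0s (radExt r) (distExt O)
                ({j.castSucc, Fin.last n} : Finset (Fin (n + 1))) *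
              B0s (radExt r) (distExt O)
                ({k.castSucc, Fin.last n} : Finset (Fin (n + 1))))) := by
  have hconst : ∀ j, c j * u0 j = ‖O j‖ ^ 2 - r j ^ 2 + 1 := fun j => by
    have h := hnormal j 0
    simp at h
    linarith
  have hcoef : ∀ j ν, c j * u j ν = -2 * O j ν := fun j ν => by
    have h := hnormal j (EuclideanSpace.single ν 1)
    simp [EuclideanSpace.inner_single_right] at h
    linarith [hconst j]
  have hgram : ∀ j k, c j * c k * ((∑ ν, u j ν * u k ν) - u0 j * u0 k) =
      -Bdet (radExt r) (distExt O)
        ![Lbl.zero, Lbl.star, Lbl.idx j.castSucc, Lbl.idx (Fin.last n)]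
        ![Lbl.zero, Lbl.star, Lbl.idx k.castSucc, Lbl.idx (Fin.last n)] := fun j k => by
    have hsum : c j * c k * ∑ ν, u j ν * u k ν = 4 * inner ℝ (O j) (O k) := by
      rw [PiLp.inner_apply, Finset.mul_sum, Finset.mul_sum]
      refine Finset.sum_congr rfl fun ν _ => ?_
      simp only [RCLike.inner_apply, conj_trivial]
      linear_combination c k * u k ν * hcoef j ν - 2 * O j ν * hcoef k ν
    rw [Bdet_zero_star_idx_last, ← hconst, ← hconst]
    linear_combination hsum
  have hB : ∀ j : Fin n, B0s (radExt r) (distExt O)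
      ({j.castSucc, Fin.last n} : Finset (Fin (n + 1))) = -c j ^ 2 := fun j => by
    have h := hgram j j
    rw [← B0s_pair _ _ j.castSucc_lt_last] at h
    have hj := hnorm j
    simp only [pow_two] at hj ⊢
    rw [hj] at h
    linarith
  refine ⟨fun j => ?_, fun j k => ?_⟩
  · rw [hB, neg_neg, Real.sqrt_sq (hc j).le, Bdet_zero_idx_last, ← hconst,
      mul_div_cancel_left₀ _ (hc j).ne']
  · rw [hB, hB, neg_mul_neg, ← mul_pow, Real.sqrt_sq (mul_pos (hc j) (hc k)).le, ← hgram,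
      mul_div_cancel_left₀ _ (mul_pos (hc j) (hc k)).ne']

end SchlafliVol
end
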